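/- arXiv:1111.6278 — 4 statements merged into one kernel-verified Lean document; each statement's English description precedes it below -/
import Mathlib

section
/- Let G be a connected bipartite simple graph with s ≥ 2 edges, and suppose H_1,…,H_m are cycle subgraphs of G with pairwise disjoint vertex sets such that every cycle of G coincides with one of H_1,…,H_m. For 1 ≤ i ≤ m, let E_i ⊆ {1,…,s} be the set of indices of the edges of H_i and let I_i(X) = I(X) ∩ K[t_j : j ∈ E_i]. Then the vanishing ideal I(X) is generated, as an ideal of S, by the union of the set {t_i^{q−1} − t_j^{q−1} : 1 ≤ i, j ≤ s} with I_1(X) ∪ ⋯ ∪ I_m(X). -/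
open MvPolynomial

noncomputable section

/-- For `x : Fin n → M` and an edge `E = {j,k}` (as an element of `Sym2 (Fin n)`),
`edgeProd x E = x j * x k`. -/
def edgeProd {M : Type} [CommMonoid M] {n : ℕ} (x : Fin n → M) (E : Sym2 (Fin n)) : M :=
  Sym2.lift ⟨fun a b => x a * x b, fun a b => mul_comm (x a) (x b)⟩ E

/-- The vanishing ideal `I(X) ⊆ K[t_1,…,t_s]` of the algebraic toric set parameterized by
the edges `e_1,…,e_s` of a graph. -/
def graphVanishingIdeal (K : Type) [Field K] {n s : ℕ} (e : Fin s → Sym2 (Fin n)) :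
    Ideal (MvPolynomial (Fin s) K) :=
  Ideal.span {f | (∃ d, f.IsHomogeneous d) ∧
    ∀ x : Fin n → Kˣ, eval (fun i => ((edgeProd x (e i) : Kˣ) : K)) f = 0}

theorem edgeProd_mk {M : Type} [CommMonoid M] {n : ℕ} (x : Fin n → M) (u v : Fin n) :
    edgeProd x s(u, v) = x u * x v := rfl

theorem edgeProd_mul {M : Type} [CommMonoid M] {n : ℕ} (x y : Fin n → M) (E : Sym2 (Fin n)) :
    edgeProd (x * y) E = edgeProd x E * edgeProd y E := by
  induction E using Sym2.ind with
  | _ u v => simp only [edgeProd_mk, Pi.mul_apply]; exact mul_mul_mul_comm _ _ _ _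

theorem edgeProd_one {M : Type} [CommMonoid M] {n : ℕ} (E : Sym2 (Fin n)) :
    edgeProd (1 : Fin n → M) E = 1 := by
  induction E using Sym2.ind with
  | _ u v => simp [edgeProd_mk]

theorem edgeProd_congr {M : Type} [CommMonoid M] {n : ℕ} (x y : Fin n → M) (E : Sym2 (Fin n))
    (h : ∀ v ∈ E, x v = y v) : edgeProd x E = edgeProd y E := by
  induction E using Sym2.ind with
  | _ u v => simp only [edgeProd_mk]; rw [h u (by simp), h v (by simp)]

/-- Combining local relations, in a commutative ring, into a global one. -/
theorem combine_parts {R P : Type*} [CommRing R] [Fintype P] (u : R) (α β : P → R) (A B : P → ℕ)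
    (N : ℕ) (hN : 0 < N) (hmod : ∀ p, A p ≡ B p [MOD N]) (hsum : ∑ p, A p = ∑ p, B p)
    (h1 : ∀ p, B p ≤ A p → α p = β p * u ^ ((A p - B p) / N))
    (h2 : ∀ p, A p ≤ B p → β p = α p * u ^ ((B p - A p) / N)) :
    ∏ p, α p = ∏ p, β p := by
  classical
  have hA : ∀ p, B p ≤ A p → A p = B p + N * ((A p - B p) / N) := by
    intro p hp
    rw [Nat.mul_div_cancel' ((Nat.modEq_iff_dvd' hp).1 (hmod p).symm)]; omega
  have hB : ∀ p, A p ≤ B p → B p = A p + N * ((B p - A p) / N) := by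
    intro p hp
    rw [Nat.mul_div_cancel' ((Nat.modEq_iff_dvd' hp).1 (hmod p))]; omega
  rw [← Finset.prod_filter_mul_prod_filter_not Finset.univ (fun p => B p ≤ A p) α,
    ← Finset.prod_filter_mul_prod_filter_not Finset.univ (fun p => B p ≤ A p) β]
  rw [← Finset.sum_filter_add_sum_filter_not Finset.univ (fun p => B p ≤ A p) A,
    ← Finset.sum_filter_add_sum_filter_not Finset.univ (fun p => B p ≤ A p) B] at hsum
  have e1 : ∏ p with B p ≤ A p, α p =
      (∏ p with B p ≤ A p, β p) * u ^ (∑ p with B p ≤ A p, (A p - B p) / N) := by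
    rw [← Finset.prod_pow_eq_pow_sum, ← Finset.prod_mul_distrib]
    exact Finset.prod_congr rfl fun p hp => h1 p (Finset.mem_filter.1 hp).2
  have e2 : ∏ p with ¬ B p ≤ A p, β p =
      (∏ p with ¬ B p ≤ A p, α p) * u ^ (∑ p with ¬ B p ≤ A p, (B p - A p) / N) := by
    rw [← Finset.prod_pow_eq_pow_sum, ← Finset.prod_mul_distrib]
    exact Finset.prod_congr rfl fun p hp => h2 p (le_of_not_ge (Finset.mem_filter.1 hp).2)
  have s1 : ∑ p with B p ≤ A p, A p =
      (∑ p with B p ≤ A p, B p) + N * (∑ p with B p ≤ A p, (A p - B p) / N) := by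
    rw [Finset.mul_sum, ← Finset.sum_add_distrib]
    exact Finset.sum_congr rfl fun p hp => hA p (Finset.mem_filter.1 hp).2
  have s2 : ∑ p with ¬ B p ≤ A p, B p =
      (∑ p with ¬ B p ≤ A p, A p) + N * (∑ p with ¬ B p ≤ A p, (B p - A p) / N) := by
    rw [Finset.mul_sum, ← Finset.sum_add_distrib]
    exact Finset.sum_congr rfl fun p hp => hB p (le_of_not_ge (Finset.mem_filter.1 hp).2)
  have s3 : (∑ p with B p ≤ A p, (A p - B p) / N) = ∑ p with ¬ B p ≤ A p, (B p - A p) / N := by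
    apply Nat.eq_of_mul_eq_mul_left hN
    omega
  rw [e1, e2, s3]
  ring

/-- On a bridge, the exponents agree as characters. -/
theorem bridge_pow {n s : ℕ} {K : Type} [Field K] (e : Fin s → Sym2 (Fin n))
    (he : Function.Injective e) (hnd : ∀ i, ¬ (e i).IsDiag)
    (G : SimpleGraph (Fin n)) (hG : G = SimpleGraph.fromEdgeSet (Set.range e))
    (hbip : G.Colorable 2) (j : Fin s)
    (hj : ∀ (v : Fin n) (w : G.Walk v v), w.IsCycle → e j ∉ w.edges)
    (a b : Fin s → ℕ)
    (hab : ∀ x : Fin n → Kˣ, ∏ i, edgeProd x (e i) ^ a i = ∏ i, edgeProd x (e i) ^ b i)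
    (g : Kˣ) : g ^ a j = g ^ b j := by
  classical
  obtain ⟨c⟩ := hbip
  have hmem : ∀ i, e i ∈ G.edgeSet := by
    intro i
    rw [hG, SimpleGraph.edgeSet_fromEdgeSet]
    exact ⟨⟨i, rfl⟩, by simpa using hnd i⟩
  have hbr : G.IsBridge (e j) :=
    (SimpleGraph.isBridge_iff_forall_cycle_notMem (hmem j)).2 fun v w hw => hj v w hw
  obtain ⟨u, v, huv⟩ : ∃ u v, e j = s(u, v) := by
    induction h : e j using Sym2.ind with
    | _ u v => exact ⟨u, v, rfl⟩
  rw [huv, SimpleGraph.isBridge_iff] at hbr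
  set G' := G.deleteEdges {s(u, v)} with hG'
  let x : Fin n → Kˣ := fun w => if G'.Reachable u w then (if c w = c u then g else g⁻¹) else 1
  have hxj : edgeProd x (e j) = g := by
    rw [huv, edgeProd_mk]
    simp [x, hbr]
  have hxi : ∀ i, i ≠ j → edgeProd x (e i) = 1 := by
    intro i hij
    have hne : e i ≠ s(u, v) := by
      rw [← huv]; exact fun h => hij (he h)
    have hm := hmem i
    revert hm hne
    induction e i using Sym2.ind with
    | _ p r =>
      intro hne hm
      rw [SimpleGraph.mem_edgeSet] at hm
      have hadj : G'.Adj p r := by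
        rw [hG', SimpleGraph.deleteEdges_adj]
        exact ⟨hm, by simpa using hne⟩
      have hiff : G'.Reachable u p ↔ G'.Reachable u r :=
        ⟨fun h => h.trans hadj.reachable, fun h => h.trans hadj.symm.reachable⟩
      have hc := c.valid hm
      rw [edgeProd_mk]
      simp only [x]
      by_cases h : G'.Reachable u r
      · simp only [hiff, h, if_true]
        by_cases h1 : c p = c u
        · have h2 : ¬ c r = c u := fun h => hc (h1.trans h.symm)
          simp [h1, h2]
        · have h2 : c r = c u := by omega
          simp [h1, h2]
      · simp [hiff, h]
  have := hab x
  rw [Finset.prod_eq_single j (fun i _ hi => by rw [hxi i hi, one_pow]) (by simp),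
    Finset.prod_eq_single j (fun i _ hi => by rw [hxi i hi, one_pow]) (by simp), hxj] at this
  exact this

theorem modEq_of_forall_pow {K : Type} [Field K] [Fintype K] (A B : ℕ)
    (h : ∀ g : Kˣ, g ^ A = g ^ B) : A ≡ B [MOD Fintype.card K - 1] := by
  classical
  obtain ⟨g, hg⟩ := IsCyclic.exists_generator (α := Kˣ)
  have := pow_eq_pow_iff_modEq.1 (h g)
  rwa [orderOf_eq_card_of_forall_mem_zpowers hg, Nat.card_eq_fintype_card,
    Fintype.card_units] at this

/-- A homogeneous binomial supported on `P`, with values agreeing, lies in the vanishing ideal. -/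
theorem part_rel {n s : ℕ} {K : Type} [Field K] [Fintype K] (e : Fin s → Sym2 (Fin n))
    (P : Finset (Fin s)) (j₀ : Fin s) (hj₀ : j₀ ∈ P) (a b : Fin s → ℕ) (r : ℕ)
    (hdeg : ∑ i ∈ P, a i = ∑ i ∈ P, b i + (Fintype.card K - 1) * r)
    (hab : ∀ x : Fin n → Kˣ, ∏ i ∈ P, edgeProd x (e i) ^ a i = ∏ i ∈ P, edgeProd x (e i) ^ b i) :
    ((∏ i ∈ P, (X i : MvPolynomial (Fin s) K) ^ a i)
      - (∏ i ∈ P, X i ^ b i) * X j₀ ^ ((Fintype.card K - 1) * r)) ∈ graphVanishingIdeal K e ∧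
    ((∏ i ∈ P, (X i : MvPolynomial (Fin s) K) ^ a i)
      - (∏ i ∈ P, X i ^ b i) * X j₀ ^ ((Fintype.card K - 1) * r)) ∈
        MvPolynomial.supported K (↑P : Set (Fin s)) := by
  constructor
  · apply Ideal.subset_span
    refine ⟨⟨∑ i ∈ P, a i, ?_⟩, ?_⟩
    · apply MvPolynomial.IsHomogeneous.sub
      · exact MvPolynomial.IsHomogeneous.prod _ _ _ fun i _ => isHomogeneous_X_pow i _
      · rw [hdeg]
        exact (MvPolynomial.IsHomogeneous.prod _ _ _ fun i _ => isHomogeneous_X_pow i _).mul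
          (isHomogeneous_X_pow _ _)
    · intro x
      have h := congrArg (fun z : Kˣ => (z : K)) (hab x)
      simp only [Units.coe_prod, Units.val_pow_eq_pow_val] at h
      simp only [map_sub, map_mul, map_prod, map_pow, eval_X]
      rw [h, pow_mul, FiniteField.pow_card_sub_one_eq_one _ (Units.ne_zero _)]
      simp
  · have hX : ∀ i ∈ P, (X i : MvPolynomial (Fin s) K) ∈ MvPolynomial.supported K (↑P : Set (Fin s)) :=
      fun i hi => Algebra.subset_adjoin ⟨i, hi, rfl⟩
    exact Subalgebra.sub_mem _ (Subalgebra.prod_mem _ fun i hi => Subalgebra.pow_mem _ (hX i hi) _)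
      (Subalgebra.mul_mem _ (Subalgebra.prod_mem _ fun i hi => Subalgebra.pow_mem _ (hX i hi) _)
        (Subalgebra.pow_mem _ (hX _ hj₀) _))

/-- On a cycle part, the characters agree. -/
theorem cycle_part {n s m : ℕ} {K : Type} [Field K] (e : Fin s → Sym2 (Fin n))
    (E : Fin m → Finset (Fin s))
    (hdisj : ∀ i₁ i₂ : Fin m, i₁ ≠ i₂ → ∀ v : Fin n,
      (∃ j ∈ E i₁, v ∈ e j) → ¬ (∃ j ∈ E i₂, v ∈ e j))
    (a b : Fin s → ℕ)
    (hbr : ∀ j, (∀ k, j ∉ E k) → ∀ g : Kˣ, g ^ a j = g ^ b j)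
    (hab : ∀ x : Fin n → Kˣ, ∏ i, edgeProd x (e i) ^ a i = ∏ i, edgeProd x (e i) ^ b i)
    (k : Fin m) (x : Fin n → Kˣ) :
    ∏ i ∈ E k, edgeProd x (e i) ^ a i = ∏ i ∈ E k, edgeProd x (e i) ^ b i := by
  classical
  let y : Fin n → Kˣ := fun v => if ∃ j ∈ E k, v ∈ e j then x v else 1
  have hy1 : ∀ i ∈ E k, edgeProd y (e i) = edgeProd x (e i) := by
    intro i hi
    apply edgeProd_congr
    intro v hv
    exact if_pos ⟨i, hi, hv⟩
  have hy2 : ∀ i ∉ E k, edgeProd y (e i) ^ a i = edgeProd y (e i) ^ b i := by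
    intro i hi
    by_cases h : ∀ l, i ∉ E l
    · exact hbr i h _
    · push Not at h
      obtain ⟨l, hl⟩ := h
      have hlk : l ≠ k := by rintro rfl; exact hi hl
      have : edgeProd y (e i) = 1 := by
        rw [← edgeProd_one (M := Kˣ) (e i)]
        apply edgeProd_congr
        intro v hv
        exact if_neg (hdisj l k hlk v ⟨i, hl, hv⟩)
      rw [this, one_pow, one_pow]
  have h := hab y
  rw [← Finset.prod_mul_prod_compl (E k), ← Finset.prod_mul_prod_compl (E k)
      (fun i => edgeProd y (e i) ^ b i),
    Finset.prod_congr rfl (fun i hi => hy2 i (Finset.mem_compl.1 hi))] at h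
  have h' := mul_right_cancel h
  calc _ = ∏ i ∈ E k, edgeProd y (e i) ^ a i :=
        Finset.prod_congr rfl fun i hi => by rw [hy1 i hi]
    _ = ∏ i ∈ E k, edgeProd y (e i) ^ b i := h'
    _ = _ := Finset.prod_congr rfl fun i hi => by rw [hy1 i hi]

/-- The sums of exponents on a set of edges where the characters agree are congruent. -/
theorem deg_modEq {n s : ℕ} {K : Type} [Field K] [Fintype K] (e : Fin s → Sym2 (Fin n))
    (G : SimpleGraph (Fin n)) (hmem : ∀ i, e i ∈ G.edgeSet)
    (hbip : G.Colorable 2) (P : Finset (Fin s)) (a b : Fin s → ℕ)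
    (hab : ∀ x : Fin n → Kˣ, ∏ i ∈ P, edgeProd x (e i) ^ a i = ∏ i ∈ P, edgeProd x (e i) ^ b i) :
    ∑ i ∈ P, a i ≡ ∑ i ∈ P, b i [MOD Fintype.card K - 1] := by
  classical
  obtain ⟨c⟩ := hbip
  apply modEq_of_forall_pow (K := K)
  intro g
  have hx : ∀ i, edgeProd (fun v => if c v = 0 then g else 1) (e i) = g := by
    intro i
    have hm := hmem i
    revert hm
    induction e i using Sym2.ind with
    | _ p r =>
      intro hm
      have hc := c.valid (SimpleGraph.mem_edgeSet _ |>.1 hm)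
      rw [edgeProd_mk]
      by_cases h1 : c p = 0
      · have h2 : ¬ c r = 0 := fun h => hc (h1.trans h.symm)
        simp [h1, h2]
      · have h2 : c r = 0 := by omega
        simp [h1, h2]
  have h := hab (fun v => if c v = 0 then g else 1)
  simp only [hx, Finset.prod_pow_eq_pow_sum] at h
  exact h

/-- The key binomial statement. -/
theorem binomial_mem {n s m : ℕ} {K : Type} [Field K] [Fintype K] (hs : 2 ≤ s)
    (e : Fin s → Sym2 (Fin n)) (he : Function.Injective e) (hnd : ∀ i, ¬ (e i).IsDiag)
    (G : SimpleGraph (Fin n)) (hG : G = SimpleGraph.fromEdgeSet (Set.range e))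
    (hbip : G.Colorable 2) (E : Fin m → Finset (Fin s))
    (hne : ∀ k, (E k).Nonempty)
    (hdisj : ∀ i₁ i₂ : Fin m, i₁ ≠ i₂ → ∀ v : Fin n,
      (∃ j ∈ E i₁, v ∈ e j) → ¬ (∃ j ∈ E i₂, v ∈ e j))
    (hall : ∀ (v : Fin n) (w : G.Walk v v), w.IsCycle →
      ∃ i : Fin m, {x : Sym2 (Fin n) | x ∈ w.edges} = e '' ↑(E i))
    (J : Ideal (MvPolynomial (Fin s) K))
    (hJ1 : ∀ i j : Fin s, (X i : MvPolynomial (Fin s) K) ^ (Fintype.card K - 1)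
      - X j ^ (Fintype.card K - 1) ∈ J)
    (hJ2 : ∀ k f, f ∈ graphVanishingIdeal K e →
      f ∈ MvPolynomial.supported K (↑(E k) : Set (Fin s)) → f ∈ J)
    (a b : Fin s → ℕ) (hdeg : ∑ i, a i = ∑ i, b i)
    (hab : ∀ x : Fin n → Kˣ, ∏ i, edgeProd x (e i) ^ a i = ∏ i, edgeProd x (e i) ^ b i) :
    Ideal.Quotient.mk J (∏ i, X i ^ a i) = Ideal.Quotient.mk J (∏ i, X i ^ b i) := by
  classical
  have hmem : ∀ i, e i ∈ G.edgeSet := by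
    intro i
    rw [hG, SimpleGraph.edgeSet_fromEdgeSet]
    exact ⟨⟨i, rfl⟩, by simpa using hnd i⟩
  have hbr : ∀ j, (∀ k, j ∉ E k) → ∀ g : Kˣ, g ^ a j = g ^ b j := by
    intro j hj
    apply bridge_pow e he hnd G hG hbip j _ a b hab
    intro v w hw hjw
    obtain ⟨k, hk⟩ := hall v w hw
    have : e j ∈ e '' ↑(E k) := hk ▸ hjw
    obtain ⟨j', hj', h⟩ := this
    exact hj k (he h ▸ hj')
  have hN : 0 < Fintype.card K - 1 := by
    have := Fintype.one_lt_card (α := K); omega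
  set N := Fintype.card K - 1 with hNdef
  set φ := Ideal.Quotient.mk J
  let i₀ : Fin s := ⟨0, by omega⟩
  set u := φ (X i₀ ^ N) with hu
  have huX : ∀ i, φ (X i) ^ N = u := by
    intro i
    rw [hu, ← map_pow]
    exact Ideal.Quotient.eq.2 (hJ1 _ _)
  let π : Fin s → Fin m ⊕ Fin s := fun j =>
    if h : ∃ k, j ∈ E k then Sum.inl h.choose else Sum.inr j
  have hEdisj : ∀ j k l, j ∈ E k → j ∈ E l → k = l := by
    intro j k l hk hl
    by_contra hkl
    have hv : ∃ v, v ∈ e j := by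
      induction e j using Sym2.ind with
      | _ p r => exact ⟨p, by simp⟩
    obtain ⟨v, hv⟩ := hv
    exact hdisj k l hkl v ⟨j, hk, hv⟩ ⟨j, hl, hv⟩
  have hfl : ∀ k, (Finset.univ.filter fun j => π j = Sum.inl k) = E k := by
    intro k
    ext j
    simp only [Finset.mem_filter, Finset.mem_univ, true_and, π]
    constructor
    · intro h
      split_ifs at h with hh
      · have h3 := Sum.inl.inj h
        exact h3 ▸ hh.choose_spec
    · intro h
      have hh : ∃ k, j ∈ E k := ⟨k, h⟩
      rw [dif_pos hh]
      exact congrArg _ (hEdisj j _ _ hh.choose_spec h)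
  have hfr : ∀ i, (Finset.univ.filter fun j => π j = Sum.inr i) = {i} ∧ (∀ k, i ∉ E k) ∨
      (Finset.univ.filter fun j => π j = Sum.inr i) = ∅ := by
    intro i
    by_cases hi : ∃ k, i ∈ E k
    · right
      ext j
      simp only [Finset.mem_filter, Finset.mem_univ, true_and, π, Finset.notMem_empty, iff_false]
      intro h
      split_ifs at h with hh
      exact hh (Sum.inr.inj h ▸ hi)
    · left
      refine ⟨?_, by push Not at hi; exact hi⟩
      ext j
      simp only [Finset.mem_filter, Finset.mem_univ, true_and, π, Finset.mem_singleton]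
      constructor
      · intro h
        split_ifs at h with hh
        exact Sum.inr.inj h
      · rintro rfl
        rw [dif_neg hi]
  have hcyc1 := cycle_part e E hdisj a b hbr hab
  have hcyc2 := cycle_part e E hdisj b a (fun j hj g => (hbr j hj g).symm) (fun x => (hab x).symm)
  have hmodk := fun k => deg_modEq e G hmem hbip (E k) a b (hcyc1 k)
  -- the local relation
  have key : ∀ a b : Fin s → ℕ,
      (∀ k (x : Fin n → Kˣ), ∏ i ∈ E k, edgeProd x (e i) ^ a i = ∏ i ∈ E k, edgeProd x (e i) ^ b i) →
      (∀ j, (∀ k, j ∉ E k) → a j ≡ b j [MOD N]) →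
      ∀ p : Fin m ⊕ Fin s, (∑ j with π j = p, b j ≤ ∑ j with π j = p, a j) →
      ∏ j with π j = p, φ (X j) ^ a j = (∏ j with π j = p, φ (X j) ^ b j) *
        u ^ ((∑ j with π j = p, a j - ∑ j with π j = p, b j) / N) := by
    intro a b hc hb p hp
    rcases p with k | i
    · rw [hfl] at hp ⊢
      have hmod := deg_modEq e G hmem hbip (E k) a b (hc k)
      have hd : ∑ j ∈ E k, a j = ∑ j ∈ E k, b j + N * ((∑ j ∈ E k, a j - ∑ j ∈ E k, b j) / N) := by
        rw [Nat.mul_div_cancel' ((Nat.modEq_iff_dvd' hp).1 hmod.symm)]; omega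
      obtain ⟨j₀, hj₀⟩ := hne k
      obtain ⟨h1, h2⟩ := part_rel e (E k) j₀ hj₀ a b _ hd (hc k)
      have := Ideal.Quotient.eq.2 (hJ2 k _ h1 h2)
      rw [map_prod, map_mul, map_prod, map_pow, ← hNdef, pow_mul] at this
      simp only [map_pow] at this
      change _ = _ * (φ (X j₀) ^ N) ^ _ at this
      rw [huX] at this
      exact this
    · rcases hfr i with ⟨h, hi⟩ | h
      · rw [h] at hp ⊢
        simp only [Finset.sum_singleton, Finset.prod_singleton] at hp ⊢
        rw [← huX i, ← pow_mul, ← pow_add,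
          Nat.mul_div_cancel' ((Nat.modEq_iff_dvd' hp).1 (hb i hi).symm)]
        congr 1; omega
      · rw [h]; simp
  have hbmod : ∀ j, (∀ k, j ∉ E k) → a j ≡ b j [MOD N] := fun j hj =>
    modEq_of_forall_pow (K := K) _ _ (hbr j hj)
  simp only [map_prod, map_pow]
  rw [← Finset.prod_fiberwise Finset.univ π, ← Finset.prod_fiberwise Finset.univ π
    (fun j => φ (X j) ^ b j)]
  refine combine_parts u _ _ (fun p => ∑ j with π j = p, a j) (fun p => ∑ j with π j = p, b j) N hN
    ?_ ?_ (key a b hcyc1 hbmod) (key b a hcyc2 fun j hj => (hbmod j hj).symm)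
  · rintro (k | i)
    · simp only [hfl]; exact hmodk k
    · rcases hfr i with ⟨h, hi⟩ | h
      · simp only [h, Finset.sum_singleton]; exact hbmod i hi
      · simp only [h, Finset.sum_empty]; rfl
  · rw [Finset.sum_fiberwise, Finset.sum_fiberwise]; exact hdeg

/-- The character of the torus attached to an exponent. -/
def expChar {n s : ℕ} (K : Type) [Field K] (e : Fin s → Sym2 (Fin n)) (d : Fin s →₀ ℕ) :
    (Fin n → Kˣ) →* K where
  toFun x := ((∏ i, edgeProd x (e i) ^ d i : Kˣ) : K)
  map_one' := by simp [edgeProd_one]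
  map_mul' x y := by
    simp only [edgeProd_mul, mul_pow, Finset.prod_mul_distrib, Units.val_mul]

theorem monomial_eq_prod {s : ℕ} {K : Type} [Field K] (d : Fin s →₀ ℕ) (c : K) :
    monomial d c = C c * ∏ i, X i ^ d i := by
  rw [monomial_eq, Finsupp.prod_fintype _ _ (by simp)]

/-- A homogeneous polynomial vanishing on the toric set is a combination of binomials. -/
theorem homogeneous_mem {n s : ℕ} {K : Type} [Field K] (e : Fin s → Sym2 (Fin n))
    (J : Ideal (MvPolynomial (Fin s) K))
    (hJ : ∀ a b : Fin s → ℕ, ∑ i, a i = ∑ i, b i →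
      (∀ x : Fin n → Kˣ, ∏ i, edgeProd x (e i) ^ a i = ∏ i, edgeProd x (e i) ^ b i) →
      Ideal.Quotient.mk J (∏ i, X i ^ a i) = Ideal.Quotient.mk J (∏ i, X i ^ b i))
    (f : MvPolynomial (Fin s) K) (D : ℕ) (hf : f.IsHomogeneous D)
    (hv : ∀ x : Fin n → Kˣ, eval (fun i => ((edgeProd x (e i) : Kˣ) : K)) f = 0) : f ∈ J := by
  classical
  have hsum : ∀ d ∈ f.support, ∑ i, d i = D := by
    intro d hd
    have := hf (mem_support_iff.1 hd)
    rw [← Finsupp.degree_eq_sum, ← this, Finsupp.degree_eq_weight_one]; rfl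
  have hfiber : ∀ χ ∈ f.support.image (expChar K e),
      ∑ d ∈ f.support with expChar K e d = χ, f.coeff d = 0 := by
    refine linearIndependent_iff'.1 (linearIndependent_monoidHom (Fin n → Kˣ) K) _ _ ?_
    ext x
    rw [Finset.sum_apply, Pi.zero_apply, ← hv x, eval_eq',
      ← Finset.sum_fiberwise_of_maps_to (t := f.support.image (expChar K e)) (g := expChar K e)
        (fun d hd => Finset.mem_image_of_mem _ hd)]
    apply Finset.sum_congr rfl
    intro χ _
    rw [Pi.smul_apply, smul_eq_mul, Finset.sum_mul]
    apply Finset.sum_congr rfl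
    intro d hd
    rw [← (Finset.mem_filter.1 hd).2]
    simp [expChar]
  rw [← Ideal.Quotient.eq_zero_iff_mem]
  conv_lhs => rw [f.as_sum]
  rw [map_sum, ← Finset.sum_fiberwise_of_maps_to (t := f.support.image (expChar K e))
    (g := expChar K e) (fun d hd => Finset.mem_image_of_mem _ hd)]
  apply Finset.sum_eq_zero
  intro χ hχ
  have h0 := hfiber χ hχ
  obtain ⟨d₀, hd₀, rfl⟩ := Finset.mem_image.1 hχ
  have : ∀ d ∈ f.support.filter (fun d => expChar K e d = expChar K e d₀),
      Ideal.Quotient.mk J (monomial d (f.coeff d)) =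
        Ideal.Quotient.mk J (C (f.coeff d)) * Ideal.Quotient.mk J (∏ i, X i ^ d₀ i) := by
    intro d hd
    obtain ⟨hd1, hd2⟩ := Finset.mem_filter.1 hd
    rw [monomial_eq_prod, map_mul, hJ d d₀ ((hsum d hd1).trans (hsum d₀ hd₀).symm)]
    intro x
    exact Units.ext (DFunLike.congr_fun hd2 x)
  rw [Finset.sum_congr rfl this, ← Finset.sum_mul, ← map_sum, ← map_sum, h0]
  simp


/-- Let `G` be a connected bipartite simple graph with `s ≥ 2` edges whose
cycles `H_1,…,H_m` have pairwise disjoint vertex sets, the cycle `H_i` having edge-index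
set `E_i ⊆ {1,…,s}`.  With `I_i(X) = I(X) ∩ K[t_j : j ∈ E_i]`, the ideal `I(X)` is
generated by the toric relations `t_i^{q−1} − t_j^{q−1}` together with
`I_1(X) ∪ ⋯ ∪ I_m(X)`. -/
theorem vanishing_ideal_generators_disjoint_cycles
    (q n s m : ℕ) (hq : 2 < q) (hs : 2 ≤ s) (K : Type) [Field K] [Fintype K]
    (hcard : Fintype.card K = q)
    (e : Fin s → Sym2 (Fin n)) (he : Function.Injective e)
    (hnd : ∀ i, ¬ (e i).IsDiag)
    (hiso : ∀ v : Fin n, ∃ i, v ∈ e i)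
    (G : SimpleGraph (Fin n)) (hG : G = SimpleGraph.fromEdgeSet (Set.range e))
    (hconn : G.Connected) (hbip : G.Colorable 2)
    (E : Fin m → Finset (Fin s))
    -- each `H_i` is a cycle subgraph of `G`, with edge set `{e j : j ∈ E i}`
    (hcyc : ∀ i : Fin m, ∃ (v : Fin n) (w : G.Walk v v), w.IsCycle ∧
      {x : Sym2 (Fin n) | x ∈ w.edges} = e '' ↑(E i))
    -- the vertex sets of the `H_i` are pairwise disjoint
    (hdisj : ∀ i₁ i₂ : Fin m, i₁ ≠ i₂ → ∀ v : Fin n,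
      (∃ j ∈ E i₁, v ∈ e j) → ¬ (∃ j ∈ E i₂, v ∈ e j))
    -- every cycle of `G` coincides with one of `H_1,…,H_m`
    (hall : ∀ (v : Fin n) (w : G.Walk v v), w.IsCycle →
      ∃ i : Fin m, {x : Sym2 (Fin n) | x ∈ w.edges} = e '' ↑(E i)) :
    graphVanishingIdeal K e = Ideal.span
      ({p : MvPolynomial (Fin s) K | ∃ i j : Fin s, p = X i ^ (q - 1) - X j ^ (q - 1)} ∪
       ⋃ i : Fin m, {f : MvPolynomial (Fin s) K |
          f ∈ graphVanishingIdeal K e ∧ f ∈ MvPolynomial.supported K (↑(E i) : Set (Fin s))}) := by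
  subst hcard
  apply le_antisymm
  · refine Ideal.span_le.2 ?_
    rintro f ⟨⟨D, hD⟩, hv⟩
    refine homogeneous_mem e _ ?_ f D hD hv
    intro a b hdeg hab
    have hne : ∀ k, (E k).Nonempty := by
      intro k
      obtain ⟨v, w, hw, hk⟩ := hcyc k
      by_contra hemp
      rw [Finset.not_nonempty_iff_eq_empty] at hemp
      rw [hemp] at hk
      have h3 := hw.three_le_length
      rw [← SimpleGraph.Walk.length_edges] at h3
      obtain ⟨x, hx⟩ := List.exists_mem_of_length_pos (l := w.edges) (by omega)
      have : x ∈ e '' (↑(∅ : Finset (Fin s)) : Set (Fin s)) := hk ▸ hx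
      simp at this
    refine binomial_mem hs e he hnd G hG hbip E hne hdisj hall _ ?_ ?_ a b hdeg hab
    · intro i j
      exact Ideal.subset_span (Or.inl ⟨i, j, rfl⟩)
    · intro k f h1 h2
      exact Ideal.subset_span (Or.inr (Set.mem_iUnion.2 ⟨k, h1, h2⟩))
  · refine Ideal.span_le.2 ?_
    rintro f (⟨i, j, rfl⟩ | hf)
    · apply Ideal.subset_span
      refine ⟨⟨Fintype.card K - 1, (isHomogeneous_X_pow _ _).sub (isHomogeneous_X_pow _ _)⟩, ?_⟩
      intro x
      simp only [map_sub, map_pow, eval_X]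
      rw [FiniteField.pow_card_sub_one_eq_one _ (Units.ne_zero _),
        FiniteField.pow_card_sub_one_eq_one _ (Units.ne_zero _), sub_self]
    · obtain ⟨k, h1, h2⟩ := Set.mem_iUnion.1 hf
      exact h1
end
end

section
/- Let G = C_{2k} be the even cycle (k ≥ 2, s = 2k). Then H_X(d) = |X| for every integer d ≥ (q−2)(k−1), and H_X((q−2)(k−1)−1) < |X|. In other words, the regularity of S/I(X), namely the least nonnegative integer ℓ such that H_X(d) = |X| for all d ≥ ℓ, equals (q−2)(k−1). -/
open MvPolynomial

noncomputable section

/-- The algebraic toric set `X* = {(x_1x_2, x_2x_3, …, x_{2k}x_1) : x ∈ (Kˣ)^{2k}}`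
parameterized by the edges of the even cycle `C_{2k}`. -/
def cycleXstar (K : Type) [Field K] (k : ℕ) : Set (Fin (2 * k) → Kˣ) :=
  Set.range fun x : Fin (2 * k) → Kˣ => fun i => x i * x (finRotate (2 * k) i)

/-- The Hilbert function `H_X(d)`: the dimension over `K` of the space of tuples
`(f(x))_{x ∈ X*}` for `f` homogeneous of degree `d`. -/
def hilbertFn (K : Type) [Field K] {s : ℕ} (Y : Set (Fin s → Kˣ)) (d : ℕ) : ℕ :=
  Module.finrank K (Submodule.span K
    {g : ↥Y → K | ∃ f : MvPolynomial (Fin s) K, f.IsHomogeneous d ∧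
      g = fun y => eval (fun i => ((y.1 i : Kˣ) : K)) f})

/-- The diagonal subgroup `Λ = {(λ,…,λ) : λ ∈ Kˣ}` of `(Kˣ)ˢ`. -/
def diagSubgroup (K : Type) [Field K] (s : ℕ) : Subgroup (Fin s → Kˣ) where
  carrier := {y | ∃ l : Kˣ, y = fun _ => l}
  one_mem' := ⟨1, rfl⟩
  mul_mem' := by rintro _ _ ⟨a, rfl⟩ ⟨b, rfl⟩; exact ⟨a * b, rfl⟩
  inv_mem' := by rintro _ ⟨a, rfl⟩; exact ⟨a⁻¹, rfl⟩

/-- `|X|`: the cardinality of the image `X` of `Y = X* ⊆ (Kˣ)ˢ` under the quotient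
homomorphism `(Kˣ)ˢ → (Kˣ)ˢ/Λ`. -/
def XCard (K : Type) [Field K] {s : ℕ} (Y : Set (Fin s → Kˣ)) : ℕ :=
  Nat.card ((fun y : Fin s → Kˣ =>
    (QuotientGroup.mk y : (Fin s → Kˣ) ⧸ diagSubgroup K s)) '' Y)


namespace EvenCycle

variable {K : Type} [Field K]

/-- Functions on `Y` that are homogeneous of degree `d` under the diagonal. -/
def homFun (K : Type) [Field K] {s : ℕ} (Y : Set (Fin s → Kˣ)) (d : ℕ) : Submodule K (↥Y → K) where
  carrier := {g | ∀ (y y' : Y) (l : Kˣ), (∀ i, y'.1 i = l * y.1 i) → g y' = (l : K) ^ d * g y}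
  zero_mem' := by intro y y' l _; simp
  add_mem' := by
    intro a b ha hb y y' l h
    simp only [Pi.add_apply, ha y y' l h, hb y y' l h]; ring
  smul_mem' := by
    intro c a ha y y' l h
    simp only [Pi.smul_apply, smul_eq_mul, ha y y' l h]; ring

theorem finrank_homFun {s : ℕ} (hs : 0 < s) [Finite K] (Y : Set (Fin s → Kˣ)) (d : ℕ) :
    Module.finrank K (homFun K Y d) = XCard K Y := by
  classical
  let Q := (fun y : Fin s → Kˣ =>
    (QuotientGroup.mk y : (Fin s → Kˣ) ⧸ diagSubgroup K s)) '' Y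
  have : Fintype Q := Fintype.ofFinite _
  have hrep : ∀ c : Q, ∃ y : Y,
      (QuotientGroup.mk y.1 : (Fin s → Kˣ) ⧸ diagSubgroup K s) = c.1 := by
    rintro ⟨_, y, hy, rfl⟩; exact ⟨⟨y, hy⟩, rfl⟩
  choose r hr using hrep
  let p : Y → Q := fun y => ⟨_, y.1, y.2, rfl⟩
  have hp : ∀ c, p (r c) = c := fun c => Subtype.ext (hr c)
  let z : Fin s := ⟨0, hs⟩
  let lam : Y → Kˣ := fun y => y.1 z * ((r (p y)).1 z)⁻¹
  have hlam : ∀ y i, y.1 i = lam y * (r (p y)).1 i := by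
    intro y i
    have h1 : (QuotientGroup.mk (r (p y)).1 : (Fin s → Kˣ) ⧸ diagSubgroup K s)
        = QuotientGroup.mk y.1 := hr (p y)
    rw [QuotientGroup.eq] at h1
    obtain ⟨l, hl⟩ := h1
    have h2 : ∀ i, y.1 i = (r (p y)).1 i * l := by
      intro i
      have := congrFun hl i
      simp only [Pi.mul_apply, Pi.inv_apply] at this
      rw [← this]; simp
    simp only [lam]
    rw [h2 i, h2 z]
    rw [mul_comm ((r (p y)).1 z) l, mul_assoc l, mul_inv_cancel, mul_one, mul_comm]
  let e : homFun K Y d ≃ₗ[K] (Q → K) :=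
    { toFun := fun g c => g.1 (r c)
      map_add' := fun _ _ => rfl
      map_smul' := fun _ _ => rfl
      invFun := fun u => ⟨fun y => (lam y : K) ^ d * u (p y), by
        intro y y' l h
        have hpp : p y' = p y := by
          apply Subtype.ext
          change (QuotientGroup.mk y'.1 : (Fin s → Kˣ) ⧸ diagSubgroup K s) = QuotientGroup.mk y.1
          rw [QuotientGroup.eq]
          refine ⟨l⁻¹, ?_⟩
          funext i
          simp [h i]
        have hl : lam y' = l * lam y := by
          simp only [lam, hpp, h z, mul_assoc]
        simp only [hpp, hl, Units.val_mul, mul_pow, mul_assoc]⟩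
      left_inv := by
        intro g
        apply Subtype.ext
        funext y
        exact (g.2 (r (p y)) y (lam y) (hlam y)).symm
      right_inv := by
        intro u
        funext c
        have h1 : lam (r c) = 1 := by simp only [lam, hp, mul_inv_cancel]
        simp only [h1, hp, Units.val_one, one_pow, one_mul] }
  rw [e.finrank_eq, Module.finrank_fintype_fun_eq_card]
  unfold XCard
  rw [Nat.card_eq_fintype_card]

/-- The space of evaluations. -/
def evSpan (K : Type) [Field K] {s : ℕ} (Y : Set (Fin s → Kˣ)) (d : ℕ) : Submodule K (↥Y → K) :=
  Submodule.span K
    {g : ↥Y → K | ∃ f : MvPolynomial (Fin s) K, f.IsHomogeneous d ∧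
      g = fun y => eval (fun i => ((y.1 i : Kˣ) : K)) f}

/-- Monomial function. -/
def mon (K : Type) [Field K] {s : ℕ} (Y : Set (Fin s → Kˣ)) (a : Fin s → ℕ) : ↥Y → K :=
  fun y => ∏ i, ((y.1 i : Kˣ) : K) ^ a i

theorem mon_mem {s : ℕ} (Y : Set (Fin s → Kˣ)) (a : Fin s → ℕ) :
    mon K Y a ∈ evSpan K Y (∑ i, a i) := by
  apply Submodule.subset_span
  refine ⟨monomial (Finsupp.equivFunOnFinite.symm a) 1, ?_, ?_⟩
  · apply isHomogeneous_monomial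
    rw [Finsupp.degree_eq_sum]; simp
  · funext y
    simp [mon, eval_monomial, Finsupp.prod_fintype]

theorem evSpan_le {s : ℕ} (Y : Set (Fin s → Kˣ)) (d : ℕ) (W : Submodule K (↥Y → K))
    (h : ∀ a : Fin s → ℕ, ∑ i, a i = d → mon K Y a ∈ W) : evSpan K Y d ≤ W := by
  unfold evSpan
  rw [Submodule.span_le]
  rintro _ ⟨f, hf, rfl⟩
  have : (fun y : Y => eval (fun i => ((y.1 i : Kˣ) : K)) f)
      = ∑ a ∈ f.support, f.coeff a • mon K Y a := by
    funext y
    simp [eval_eq', mon]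
  rw [this]
  refine Submodule.sum_mem _ fun a ha => Submodule.smul_mem _ _ (h _ ?_)
  have := hf (mem_support_iff.mp ha)
  rw [← this, ← Finsupp.degree_eq_sum]
  exact DFunLike.congr_fun (Finsupp.degree_eq_weight_one (R := ℕ)) a

theorem mon_homFun {s : ℕ} (Y : Set (Fin s → Kˣ)) (a : Fin s → ℕ) :
    mon K Y a ∈ homFun K Y (∑ i, a i) := by
  intro y y' l h
  simp only [mon, h, Units.val_mul, mul_pow, Finset.prod_mul_distrib, Finset.prod_pow_eq_pow_sum]

theorem evSpan_le_homFun {s : ℕ} (Y : Set (Fin s → Kˣ)) (d : ℕ) :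
    evSpan K Y d ≤ homFun K Y d :=
  evSpan_le Y d _ fun a ha => ha ▸ mon_homFun Y a

theorem homFun_le [Fintype K] {s : ℕ} (Y : Set (Fin s → Kˣ))
    (hY : ∀ y ∈ Y, ∀ l : Kˣ, (fun i => l * y i) ∈ Y) (d : ℕ) (W : Submodule K (↥Y → K))
    (h : ∀ a : Fin s → ℕ, (Fintype.card K - 1) ∣ (∑ i, a i) + d * (Fintype.card K - 2) →
      mon K Y a ∈ W) : homFun K Y d ≤ W := by
  classical
  intro g hg
  have hc : 1 < Fintype.card K := Fintype.one_lt_card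
  obtain ⟨f, hf⟩ : ∃ f : MvPolynomial (Fin s) K,
      ∀ y : Y, eval (fun i => ((y.1 i : Kˣ) : K)) f = g y := by
    let G : (Fin s → K) → K := fun v =>
      if hv : ∃ y : Y, (fun i => ((y.1 i : Kˣ) : K)) = v then g hv.choose else 0
    have hG : G ∈ (restrictDegree (Fin s) K (Fintype.card K - 1)).map (evalₗ K (Fin s)) := by
      rw [map_restrict_dom_evalₗ]; trivial
    obtain ⟨f, -, hf⟩ := hG
    refine ⟨f, fun y => ?_⟩
    have h1 := congrFun hf (fun i => ((y.1 i : Kˣ) : K))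
    rw [evalₗ_apply] at h1
    rw [h1]
    have hv : ∃ y' : Y, (fun i => ((y'.1 i : Kˣ) : K)) = (fun i => ((y.1 i : Kˣ) : K)) := ⟨y, rfl⟩
    simp only [G, dif_pos hv]
    congr 1
    apply Subtype.ext
    funext i
    exact Units.ext (congrFun hv.choose_spec i)
  have key : -g = ∑ a ∈ f.support,
      (f.coeff a * ∑ l : Kˣ, (l : K) ^ ((∑ i, a i) + d * (Fintype.card K - 2))) • mon K Y a := by
    funext y
    have h1 : ∀ l : Kˣ, (l : K) ^ (d * (Fintype.card K - 2)) * g ⟨_, hY y.1 y.2 l⟩ = g y := by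
      intro l
      rw [hg y ⟨_, hY y.1 y.2 l⟩ l (fun i => rfl), ← mul_assoc, ← pow_add]
      have : d * (Fintype.card K - 2) + d = (Fintype.card K - 1) * d := by
        obtain ⟨m, hm⟩ := Nat.exists_eq_add_of_lt hc
        have h2 : Fintype.card K - 2 = m := by omega
        have h3 : Fintype.card K - 1 = m + 1 := by omega
        rw [h2, h3]; ring
      rw [this, pow_mul, FiniteField.pow_card_sub_one_eq_one _ l.ne_zero, one_pow, one_mul]
    have h2 : ∑ l : Kˣ, (l : K) ^ (d * (Fintype.card K - 2)) * g ⟨_, hY y.1 y.2 l⟩ = - g y := by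
      rw [Finset.sum_congr rfl (fun l _ => h1 l), Finset.sum_const, Finset.card_univ,
        Fintype.card_units, nsmul_eq_mul, Nat.cast_sub hc.le, FiniteField.cast_card_eq_zero]
      simp
    rw [Pi.neg_apply, ← h2]
    simp only [← hf, eval_eq', Finset.sum_apply, Pi.smul_apply, smul_eq_mul, mon, Finset.mul_sum,
      Finset.sum_mul]
    rw [Finset.sum_comm]
    refine Finset.sum_congr rfl fun a _ => Finset.sum_congr rfl fun l _ => ?_
    simp only [Units.val_mul, mul_pow, Finset.prod_mul_distrib, Finset.prod_pow_eq_pow_sum, pow_add]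
    ring
  rw [← neg_neg g, key]
  refine Submodule.neg_mem _ (Submodule.sum_mem _ fun a _ => ?_)
  rw [FiniteField.sum_pow_units]
  split_ifs with hd
  · exact Submodule.smul_mem _ _ (h _ hd)
  · simp

theorem rot_parity {k : ℕ} (i : Fin (2 * k)) :
    (finRotate (2 * k) i).val % 2 = (i.val + 1) % 2 := by
  obtain ⟨N, hN⟩ : ∃ N, 2 * k = N + 1 := ⟨2 * k - 1, by have := i.2; omega⟩
  have key : ∀ M (h : M = N + 1) (i : Fin M), (finRotate M i).val = (i.val + 1) % M := by
    intro M h i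
    subst h
    rw [finRotate_succ_apply, Fin.val_add]
    rcases N with _ | N
    · simp
    · simp
  rw [key _ hN i, Nat.mod_mod_of_dvd _ (Dvd.intro _ rfl)]

theorem sum_parity (u v : ℕ) (k : ℕ) :
    ∑ i : Fin (2 * k), (if i.val % 2 = 0 then u else v) = k * (u + v) := by
  rw [Fin.sum_univ_eq_sum_range (fun i => if i % 2 = 0 then u else v)]
  induction k with
  | zero => simp
  | succ k ih =>
    rw [show 2 * (k + 1) = 2 * k + 1 + 1 by ring, Finset.sum_range_succ, Finset.sum_range_succ, ih]
    have h1 : (2 * k) % 2 = 0 := by omega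
    have h2 : ¬ (2 * k + 1) % 2 = 0 := by omega
    rw [if_pos h1, if_neg h2]; ring

theorem cycle_closed {k : ℕ} : ∀ y ∈ cycleXstar K k, ∀ l : Kˣ,
    (fun i => l * y i) ∈ cycleXstar K k := by
  rintro _ ⟨x, rfl⟩ l
  refine ⟨fun i => (if i.val % 2 = 0 then l else 1) * x i, ?_⟩
  funext i
  simp only [rot_parity i]
  rcases Nat.mod_two_eq_zero_or_one i.val with h | h
  · have h2 : ¬ (i.val + 1) % 2 = 0 := by omega
    rw [if_pos h, if_neg h2, one_mul, mul_assoc]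
  · have h2 : (i.val + 1) % 2 = 0 := by omega
    have h1 : ¬ i.val % 2 = 0 := by omega
    rw [if_pos h2, if_neg h1, one_mul, mul_left_comm]

theorem mon_cycle {k : ℕ} (a : Fin (2 * k) → ℕ) (x : Fin (2 * k) → Kˣ) :
    mon K (cycleXstar K k) a ⟨_, x, rfl⟩
      = ∏ i, (x (finRotate _ i) : K) ^ (a i + a (finRotate _ i)) := by
  simp only [mon, Units.val_mul, mul_pow, Finset.prod_mul_distrib, pow_add]
  rw [Equiv.prod_comp (finRotate (2 * k)) (fun i => (x i : K) ^ a i), mul_comm]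

theorem mon_congr [Fintype K] {k : ℕ} (a c : Fin (2 * k) → ℕ)
    (h : ∀ i, a i + a (finRotate _ i) ≡ c i + c (finRotate _ i) [MOD Fintype.card K - 1]) :
    mon K (cycleXstar K k) a = mon K (cycleXstar K k) c := by
  funext ⟨_, x, rfl⟩
  rw [mon_cycle, mon_cycle]
  refine Finset.prod_congr rfl fun i _ => ?_
  have h1 : ∀ u : Kˣ, u ^ (Fintype.card K - 1) = 1 := by
    intro u
    classical
    rw [← Fintype.card_units, pow_card_eq_one]
  have := (h i).of_dvd (orderOf_dvd_of_pow_eq_one (h1 (x (finRotate _ i))))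
  rw [← pow_eq_pow_iff_modEq] at this
  rw [← Units.val_pow_eq_pow_val, this, Units.val_pow_eq_pow_val]

theorem sum_mod (n b : ℕ) (hn : 0 < n) :
    ∑ j ∈ Finset.range n, (b + j) % n = ∑ j ∈ Finset.range n, j := by
  refine Finset.sum_bij (fun j _ => (b + j) % n) ?_ ?_ ?_ ?_
  · intro j _; exact Finset.mem_range.mpr (Nat.mod_lt _ hn)
  · intro i hi j hj h
    have : i ≡ j [MOD n] := Nat.ModEq.add_left_cancel' b h
    exact Nat.ModEq.eq_of_lt_of_lt this (Finset.mem_range.mp hi) (Finset.mem_range.mp hj)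
  · intro j hj
    have hj := Finset.mem_range.mp hj
    have hb := Nat.mod_lt b hn
    refine ⟨(j + (n - b % n)) % n, Finset.mem_range.mpr (Nat.mod_lt _ hn), ?_⟩
    rw [Nat.add_mod, Nat.mod_mod, ← Nat.add_mod]
    have h2 : b + (j + (n - b % n)) = j + n * (b / n + 1) := by
      have := Nat.div_add_mod b n
      rw [mul_add]; omega
    rw [h2, Nat.add_mul_mod_self_left, Nat.mod_eq_of_lt hj]
  · intro j _; rfl

theorem sum_mod' (n b : ℕ) (hn : 0 < n) :
    ∑ j ∈ Finset.range n, (b + (n - j)) % n = ∑ j ∈ Finset.range n, j := by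
  rw [← sum_mod n (b + 1) hn,
    ← Finset.sum_range_reflect (fun j => (b + 1 + j) % n)]
  refine Finset.sum_congr rfl fun j hj => ?_
  have := Finset.mem_range.mp hj
  congr 1; omega

/-- Every exponent vector can be moved along its coset to one of small degree. -/
theorem exists_small (n k : ℕ) (hn : 0 < n) (a : Fin (2 * k) → ℕ) :
    ∃ c : Fin (2 * k) → ℕ,
      (∀ i, a i + a (finRotate _ i) ≡ c i + c (finRotate _ i) [MOD n]) ∧
      (∑ i, a i ≡ ∑ i, c i [MOD n]) ∧ ∑ i, c i ≤ k * (n - 1) := by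
  let t : ℕ → Fin (2 * k) → ℕ := fun j i => if i.val % 2 = 0 then j else n - j
  let w : ℕ → Fin (2 * k) → ℕ := fun j i => (a i + t j i) % n
  have htot : ∑ j ∈ Finset.range n, ∑ i, w j i = ∑ j ∈ Finset.range n, k * (n - 1) := by
    rw [Finset.sum_comm]
    have : ∀ i, ∑ j ∈ Finset.range n, w j i = ∑ j ∈ Finset.range n, j := by
      intro i
      by_cases h : i.val % 2 = 0
      · simp only [w, t, if_pos h]; exact sum_mod n _ hn
      · simp only [w, t, if_neg h]; exact sum_mod' n _ hn
    simp only [this, Finset.sum_const, Finset.card_univ, Fintype.card_fin, smul_eq_mul,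
      Finset.card_range]
    have := Finset.sum_range_id_mul_two n
    calc 2 * k * ∑ j ∈ Finset.range n, j = k * ((∑ j ∈ Finset.range n, j) * 2) := by ring
      _ = n * (k * (n - 1)) := by rw [this]; ring
  obtain ⟨j, hj, hle⟩ := Finset.exists_le_of_sum_le (Finset.nonempty_range_iff.mpr hn.ne') htot.le
  have hj := Finset.mem_range.mp hj
  have hw : ∀ i, a i + t j i ≡ w j i [MOD n] := fun i => (Nat.mod_modEq _ _).symm
  refine ⟨w j, ?_, ?_, hle⟩
  · intro i
    refine Nat.ModEq.trans ?_ ((hw i).add (hw _))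
    have : t j i + t j (finRotate _ i) = n := by
      simp only [t, rot_parity]
      rcases Nat.mod_two_eq_zero_or_one i.val with h | h
      · have h2 : ¬ (i.val + 1) % 2 = 0 := by omega
        rw [if_pos h, if_neg h2]; omega
      · have h2 : (i.val + 1) % 2 = 0 := by omega
        have h1 : ¬ i.val % 2 = 0 := by omega
        rw [if_pos h2, if_neg h1]; omega
    rw [add_add_add_comm, this]
    simp [Nat.ModEq]
  · have h1 : ∑ i, (a i + t j i) ≡ ∑ i, w j i [MOD n] := by
      simp only [w, Nat.ModEq]
      exact Finset.sum_nat_mod _ _ _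
    refine Nat.ModEq.trans ?_ h1
    rw [Finset.sum_add_distrib]
    simp only [t]
    rw [sum_parity, show j + (n - j) = n by omega]
    simp [Nat.ModEq]

theorem upper [Fintype K] (k d : ℕ) (hk : 2 ≤ k) (hc : 2 < Fintype.card K)
    (hd : (Fintype.card K - 2) * (k - 1) ≤ d) :
    homFun K (cycleXstar K k) d ≤ evSpan K (cycleXstar K k) d := by
  classical
  apply homFun_le _ cycle_closed
  intro a ha
  obtain ⟨m, hm⟩ : ∃ m, Fintype.card K = m + 2 := ⟨Fintype.card K - 2, by omega⟩
  have e1 : Fintype.card K - 1 = m + 1 := by omega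
  have e2 : Fintype.card K - 2 = m := by omega
  rw [e1, e2] at ha
  rw [e2] at hd
  obtain ⟨c, hc1, hc2, hc3⟩ := exists_small (m + 1) k (by omega) a
  rw [mon_congr a c (by rw [e1]; exact hc1)]
  have hcd : ∑ i, c i ≡ d [MOD m + 1] := by
    refine hc2.symm.trans ?_
    apply Nat.ModEq.add_right_cancel' (d * m)
    rw [show d + d * m = (m + 1) * d by ring]
    exact ((Nat.modEq_zero_iff_dvd).mpr ha).trans
      ((Nat.modEq_zero_iff_dvd).mpr (Dvd.intro _ rfl)).symm
  obtain ⟨k, rfl⟩ : ∃ k', k = k' + 1 := ⟨k - 1, by omega⟩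
  have hle : ∑ i, c i ≤ d := by
    by_contra hlt
    push Not at hlt
    obtain ⟨t, ht⟩ := (Nat.modEq_iff_dvd' hlt.le).mp hcd.symm
    have ht0 : 1 ≤ t := by
      rcases Nat.eq_zero_or_pos t with h | h
      · subst h; omega
      · exact h
    have : m + 1 ≤ (m + 1) * t := Nat.le_mul_of_pos_right _ ht0
    simp only [Nat.add_sub_cancel] at hd hc3
    have : (k + 1) * m = m * k + m := by ring
    omega
  obtain ⟨t, ht⟩ := (Nat.modEq_iff_dvd' hle).mp hcd
  let z : Fin (2 * (k + 1)) := ⟨0, by omega⟩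
  let c' : Fin (2 * (k + 1)) → ℕ := fun i => c i + if i = z then (m + 1) * t else 0
  have hs : ∑ i, c' i = d := by
    simp only [c', Finset.sum_add_distrib, Finset.sum_ite_eq', Finset.mem_univ, if_true]
    omega
  have : ∀ i, c i ≡ c' i [MOD m + 1] := by
    intro i
    simp only [c']
    split_ifs
    · simp [Nat.ModEq]
    · rfl
  rw [mon_congr c c' (by rw [e1]; exact fun i => (this i).add (this _)), ← hs]
  exact mon_mem _ _

theorem lower [Fintype K] (k : ℕ) (hk : 2 ≤ k) (hc : 2 < Fintype.card K) :
    ∃ g ∈ homFun K (cycleXstar K k) ((Fintype.card K - 2) * (k - 1) - 1),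
      g ∉ evSpan K (cycleXstar K k) ((Fintype.card K - 2) * (k - 1) - 1) := by
  classical
  obtain ⟨m, hm⟩ : ∃ m, Fintype.card K = m + 2 := ⟨Fintype.card K - 2, by omega⟩
  have e1 : Fintype.card K - 1 = m + 1 := by omega
  have e2 : Fintype.card K - 2 = m := by omega
  rw [e2]
  have hm1 : 1 ≤ m := by omega
  have hpow : ∀ u : Kˣ, (u : K) ^ (m + 1) = 1 := by
    intro u
    rw [← e1]; exact FiniteField.pow_card_sub_one_eq_one _ u.ne_zero
  let b : Fin (2 * k) → ℕ := fun i => if i.val % 2 = 0 then m else 0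
  have hb : ∑ i, b i = k * m := by simp only [b]; rw [sum_parity]; simp
  have hb2 : ∀ i, b i + b (finRotate _ i) = m := by
    intro i
    simp only [b, rot_parity]
    rcases Nat.mod_two_eq_zero_or_one i.val with h | h
    · have h2 : ¬ (i.val + 1) % 2 = 0 := by omega
      rw [if_pos h, if_neg h2, add_zero]
    · have h2 : (i.val + 1) % 2 = 0 := by omega
      have h1 : ¬ i.val % 2 = 0 := by omega
      rw [if_pos h2, if_neg h1]; omega
  have hdeg : k * m = (m * (k - 1) - 1) + (m + 1) := by
    obtain ⟨k, rfl⟩ : ∃ k', k = k' + 2 := ⟨k - 2, by omega⟩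
    have : m * (k + 2 - 1) = m * k + m := by
      rw [show k + 2 - 1 = k + 1 by omega]; ring
    rw [this]
    have : (k + 2) * m = m * k + m + m := by ring
    omega
  -- the functional detecting the missing character
  let Φ : (↥(cycleXstar K k) → K) →ₗ[K] K :=
    ∑ x : Fin (2 * k) → Kˣ, (∏ i, (x (finRotate _ i) : K)) •
      LinearMap.proj (R := K) (φ := fun _ : ↥(cycleXstar K k) => K) ⟨_, x, rfl⟩
  have hΦ : ∀ a, Φ (mon K (cycleXstar K k) a)
      = ∏ i, ∑ u : Kˣ, (u : K) ^ (a i + a (finRotate _ i) + 1) := by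
    intro a
    simp only [Φ, LinearMap.sum_apply, LinearMap.smul_apply, LinearMap.proj_apply, mon_cycle,
      smul_eq_mul, ← Finset.prod_mul_distrib]
    rw [Finset.prod_univ_sum, Fintype.piFinset_univ]
    rw [← Equiv.sum_comp (Equiv.arrowCongr (finRotate (2 * k)) (Equiv.refl Kˣ))]
    refine Finset.sum_congr rfl fun x _ => Finset.prod_congr rfl fun i _ => ?_
    simp [-finRotate_apply, pow_succ, mul_comm]
  refine ⟨mon K _ b, ?_, ?_⟩
  · intro y y' l h
    rw [mon_homFun (K := K) (cycleXstar K k) b y y' l h, hb, hdeg, pow_add, hpow, mul_one]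
  · intro hmem
    have hle : evSpan K (cycleXstar K k) (m * (k - 1) - 1) ≤ LinearMap.ker Φ := by
      apply evSpan_le
      intro a ha
      rw [LinearMap.mem_ker, hΦ]
      by_contra hne
      have hdv : ∀ i, m + 1 ∣ a i + a (finRotate _ i) + 1 := by
        intro i
        by_contra hnd
        apply hne
        apply Finset.prod_eq_zero (Finset.mem_univ i)
        rw [FiniteField.sum_pow_units, e1, if_neg hnd]
      have h1 : ∑ i : Fin (2 * k), m ≤ ∑ i, (a i + a (finRotate _ i)) := by
        refine Finset.sum_le_sum fun i _ => ?_
        have := Nat.le_of_dvd (by omega) (hdv i)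
        omega
      rw [Finset.sum_add_distrib, Equiv.sum_comp (finRotate (2 * k)) a, ha] at h1
      simp only [Finset.sum_const, Finset.card_univ, Fintype.card_fin, smul_eq_mul] at h1
      rw [mul_assoc] at h1
      omega
    have h0 := hle hmem
    rw [LinearMap.mem_ker, hΦ] at h0
    rw [Finset.prod_eq_zero_iff] at h0
    obtain ⟨i, -, hi⟩ := h0
    rw [FiniteField.sum_pow_units, e1, hb2, if_pos dvd_rfl] at hi
    simp at hi

end EvenCycle

/-- Let `G = C_{2k}` (`k ≥ 2`, `s = 2k`).  Then `H_X(d) = |X|` for every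
`d ≥ (q−2)(k−1)` and `H_X((q−2)(k−1)−1) < |X|`; that is, the regularity of `S/I(X)`
equals `(q−2)(k−1)`. -/
theorem regularity_of_even_cycle
    (q k : ℕ) (hq : 2 < q) (hk : 2 ≤ k) (K : Type) [Field K] [Fintype K]
    (hcard : Fintype.card K = q) :
    (∀ d : ℕ, (q - 2) * (k - 1) ≤ d →
        hilbertFn K (cycleXstar K k) d = XCard K (cycleXstar K k)) ∧
    hilbertFn K (cycleXstar K k) ((q - 2) * (k - 1) - 1) < XCard K (cycleXstar K k) := by
  subst hcard
  have hf : ∀ d, hilbertFn K (cycleXstar K k) d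
      = Module.finrank K (EvenCycle.evSpan K (cycleXstar K k) d) := fun _ => rfl
  refine ⟨fun d hd => ?_, ?_⟩
  · rw [hf, ← EvenCycle.finrank_homFun (by omega) (cycleXstar K k) d]
    rw [le_antisymm (EvenCycle.evSpan_le_homFun (cycleXstar K k) d)
      (EvenCycle.upper k d hk hq hd)]
  · rw [hf, ← EvenCycle.finrank_homFun (by omega) (cycleXstar K k)
      ((Fintype.card K - 2) * (k - 1) - 1)]
    apply Submodule.finrank_lt_finrank_of_lt
    obtain ⟨g, hg, hg'⟩ := EvenCycle.lower (K := K) k hk hq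
    exact lt_of_le_of_ne (EvenCycle.evSpan_le_homFun _ _) (fun h => hg' (h ▸ hg))
end
end

section
/- Let G be a bipartite simple graph (not necessarily connected) with s ≥ 2 edges and no isolated vertices, and let H_1,…,H_m be subgraphs of G that are cycles of lengths 2k_1,…,2k_m with pairwise disjoint edge sets. Then H_X(d) = |X| for every integer d ≥ (q−2)·(s − (k_1+⋯+k_m) − 1); that is, the regularity of S/I(X) is at most (q−2)(s − Σ_{i=1}^m k_i − 1). -/
open MvPolynomial

noncomputable section

/-- The algebraic toric set `X* ⊆ (Kˣ)ˢ` parameterized by the edges of a graph. -/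
def graphXstar (K : Type) [Field K] {n s : ℕ} (e : Fin s → Sym2 (Fin n)) :
    Set (Fin s → Kˣ) :=
  Set.range fun x : Fin n → Kˣ => fun i => edgeProd x (e i)

lemma aux_pow_congr {K : Type} [Field K] [Fintype K] (z : Kˣ) (a b : ℤ)
    (h : (a : ZMod (Fintype.card K - 1)) = b) : z ^ a = z ^ b := by
  rw [ZMod.intCast_eq_intCast_iff_dvd_sub] at h
  obtain ⟨c, hc⟩ := h
  have hb : b = a + ((Fintype.card K - 1 : ℕ) : ℤ) * c := by linarith
  have h1 : z ^ (Fintype.card K - 1) = 1 := by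
    ext
    push_cast
    exact FiniteField.pow_card_sub_one_eq_one _ z.ne_zero
  rw [hb, zpow_add, zpow_mul, zpow_natCast, h1]
  simp

/-- The character of exponent `a`. -/
def auxChi {K : Type} [Field K] {s N : ℕ} (a : Fin s → ZMod N) (z : Fin s → Kˣ) : Kˣ :=
  ∏ j, z j ^ (a j).val

lemma auxChi_add {K : Type} [Field K] [Fintype K] {s : ℕ} [NeZero (Fintype.card K - 1)]
    (a b : Fin s → ZMod (Fintype.card K - 1)) (z : Fin s → Kˣ) :
    auxChi (a + b) z = auxChi a z * auxChi b z := by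
  unfold auxChi
  rw [← Finset.prod_mul_distrib]
  refine Finset.prod_congr rfl fun j _ => ?_
  rw [← pow_add, ← zpow_natCast, ← zpow_natCast]
  apply aux_pow_congr
  simp

lemma auxChi_mul {K : Type} [Field K] {s N : ℕ}
    (a : Fin s → ZMod N) (z w : Fin s → Kˣ) :
    auxChi a (z * w) = auxChi a z * auxChi a w := by
  simp [auxChi, mul_pow, Finset.prod_mul_distrib]

/-- Indicator like function. -/
def auxF {K : Type} [Field K] {s : ℕ} (N : ℕ) [NeZero N] (d : ℕ) (z : Fin s → Kˣ) : K :=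
  ∑ a : {a : Fin s → ZMod N // ∑ j, a j = (d : ZMod N)}, ((auxChi a.1 z : Kˣ) : K)

lemma auxF_zero {K : Type} [Field K] [Fintype K] {s : ℕ} [NeZero (Fintype.card K - 1)] (d : ℕ)
    (hN : 1 < Fintype.card K - 1)
    (z : Fin s → Kˣ) (i j : Fin s) (h : z i ≠ z j) : auxF (Fintype.card K - 1) d z = 0 := by
  classical
  have : Fact (1 < Fintype.card K - 1) := ⟨hN⟩
  have hij : i ≠ j := by rintro rfl; exact h rfl
  set a0 : Fin s → ZMod (Fintype.card K - 1) := Pi.single i 1 - Pi.single j 1 with ha0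
  have hsum : ∑ k, a0 k = 0 := by simp [a0]
  have hsum' : ∑ k, (-a0) k = 0 := by
    simp only [Pi.neg_apply, Finset.sum_neg_distrib, hsum, neg_zero]
  have hone : ∀ k : Fin s, auxChi (Pi.single k 1 : Fin s → ZMod (Fintype.card K - 1)) z = z k := by
    intro k
    unfold auxChi
    rw [Finset.prod_eq_single k]
    · simp [ZMod.val_one]
    · intro b _ hb; simp [Pi.single_eq_of_ne hb]
    · simp
  have hne : auxChi a0 z ≠ 1 := by
    intro h1
    apply h
    have h2 := auxChi_add a0 (Pi.single j 1) z
    rw [h1, one_mul, hone, ha0, sub_add_cancel, hone] at h2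
    exact h2
  let eqv : {a : Fin s → ZMod (Fintype.card K - 1) // ∑ j, a j = (d : ZMod _)} ≃
      {a : Fin s → ZMod (Fintype.card K - 1) // ∑ j, a j = (d : ZMod _)} :=
    { toFun := fun a => ⟨a0 + a.1, by
        simp only [Pi.add_apply, Finset.sum_add_distrib, hsum, a.2, zero_add]⟩
      invFun := fun a => ⟨-a0 + a.1, by
        simp only [Pi.add_apply, Finset.sum_add_distrib, hsum', a.2, zero_add]⟩
      left_inv := fun a => by ext; simp
      right_inv := fun a => by ext; simp }
  have key : auxF (Fintype.card K - 1) d z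
      = (auxChi a0 z : K) * auxF (Fintype.card K - 1) d z := by
    conv_lhs => unfold auxF
    rw [← Equiv.sum_comp eqv]
    unfold auxF
    rw [Finset.mul_sum]
    refine Finset.sum_congr rfl fun a _ => ?_
    simp only [eqv, Equiv.coe_fn_mk]
    rw [auxChi_add]; simp
  by_contra hF
  apply hne
  ext
  have : (auxChi a0 z : K) * auxF (Fintype.card K - 1) d z = 1 * auxF (Fintype.card K - 1) d z := by
    rw [← key, one_mul]
  simpa using mul_right_cancel₀ hF this

lemma auxF_one {K : Type} [Field K] [Fintype K] {s : ℕ} [NeZero (Fintype.card K - 1)] (d : ℕ)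
    (hs : 0 < s) : auxF (K := K) (s := s) (Fintype.card K - 1) d 1 ≠ 0 := by
  classical
  set N := Fintype.card K - 1 with hN
  have h0 : auxF (K := K) (s := s) N d 1
      = (Fintype.card {a : Fin s → ZMod N // ∑ j, a j = (d : ZMod N)} : K) := by
    simp [auxF, auxChi]
  rw [h0]
  have hfib : ∀ c : ZMod N, Fintype.card {a : Fin s → ZMod N // ∑ j, a j = c}
      = Fintype.card {a : Fin s → ZMod N // ∑ j, a j = (d : ZMod N)} := by
    intro c
    let a0 : Fin s → ZMod N := Pi.single ⟨0, hs⟩ ((d : ZMod N) - c)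
    have hsum : ∑ k, a0 k = d - c := by simp [a0]
    have hsum' : ∑ k, (-a0) k = c - d := by
      simp only [Pi.neg_apply, Finset.sum_neg_distrib, hsum, neg_sub]
    exact Fintype.card_congr
      { toFun := fun a => ⟨a0 + a.1, by
          simp only [Pi.add_apply, Finset.sum_add_distrib, hsum, a.2, sub_add_cancel]⟩
        invFun := fun a => ⟨-a0 + a.1, by
          simp only [Pi.add_apply, Finset.sum_add_distrib, hsum', a.2, sub_add_cancel]⟩
        left_inv := fun a => by ext; simp
        right_inv := fun a => by ext; simp }
  have htot : N ^ s = N * Fintype.card {a : Fin s → ZMod N // ∑ j, a j = (d : ZMod N)} := by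
    have h1 : Fintype.card (Fin s → ZMod N) = N ^ s := by simp [ZMod.card]
    rw [← h1, Fintype.card_congr (Equiv.sigmaFiberEquiv
      (fun a : Fin s → ZMod N => ∑ j, a j)).symm, Fintype.card_sigma]
    rw [Finset.sum_congr rfl (fun c _ => hfib c)]
    simp [ZMod.card]
  intro h
  have h2 := congrArg (Nat.cast : ℕ → K) htot
  push_cast at h2
  rw [h, mul_zero] at h2
  have hNK : (N : K) = -1 := by
    rw [hN, Nat.cast_sub Fintype.card_pos]
    simp
  rw [hNK] at h2
  exact pow_ne_zero s (by simp) h2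

lemma aux_dim {K : Type} [Field K] [Fintype K] {s : ℕ} (Y : Set (Fin s → Kˣ)) (d : ℕ)
    (hs : 0 < s) (hN : 1 < Fintype.card K - 1)
    (H : ∀ a : Fin s → ZMod (Fintype.card K - 1), ∑ j, a j = (d : ZMod _) →
      ∃ b : Fin s → ℕ, ∑ j, b j = d ∧ ∀ y ∈ Y, ∏ j, y j ^ b j = auxChi a y) :
    hilbertFn K Y d = XCard K Y := by
  classical
  have : NeZero (Fintype.card K - 1) := ⟨by omega⟩
  unfold hilbertFn XCard
  set V := Submodule.span K
    {g : ↥Y → K | ∃ f : MvPolynomial (Fin s) K, f.IsHomogeneous d ∧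
      g = fun y => eval (fun i => ((y.1 i : Kˣ) : K)) f} with hV
  set T := ((fun y : Fin s → Kˣ =>
    (QuotientGroup.mk y : (Fin s → Kˣ) ⧸ diagSubgroup K s)) '' Y) with hT
  have hsec : ∀ t : T, ∃ y : Y, (QuotientGroup.mk y.1 : (Fin s → Kˣ) ⧸ diagSubgroup K s) = t.1 := by
    rintro ⟨t, y, hy, rfl⟩
    exact ⟨⟨y, hy⟩, rfl⟩
  choose σ hσ using hsec
  have hfin : Finite T := Set.Finite.to_subtype (Set.Finite.image _ (Set.toFinite Y))
  have := Fintype.ofFinite T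
  let R : (Y → K) →ₗ[K] (T → K) := LinearMap.funLeft K K σ
  have hhom : ∀ g ∈ V, ∀ (y y' : Y) (l : Kˣ), (∀ i, y'.1 i = y.1 i * l) →
      g y' = (l : K) ^ d * g y := by
    intro g hg y y' l hl
    induction hg using Submodule.span_induction with
    | mem g hg =>
      obtain ⟨f, hf, rfl⟩ := hg
      simp only
      have : (fun i => ((y'.1 i : Kˣ) : K)) = fun i => (l : K) * ((y.1 i : Kˣ) : K) := by
        funext i; rw [hl]; push_cast; ring
      rw [this, eval_eq, eval_eq, Finset.mul_sum]
      refine Finset.sum_congr rfl fun m hm => ?_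
      have hdeg := hf (mem_support_iff.mp hm)
      simp only [mul_pow, Finset.prod_mul_distrib]
      rw [Finset.prod_pow_eq_pow_sum]
      have : ∑ i ∈ m.support, m i = d := by
        rw [← hdeg, Finsupp.weight_apply, Finsupp.sum]; simp
      rw [this]; ring
    | zero => simp
    | add g h _ _ hg hh => simp only [Pi.add_apply, hg, hh]; ring
    | smul c g _ hg => simp only [Pi.smul_apply, hg, smul_eq_mul]; ring
  have hFmem : ∀ y0 : Y, (fun y : Y => auxF (Fintype.card K - 1) d (y.1 * y0.1⁻¹)) ∈ V := by
    intro y0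
    have : (fun y : Y => auxF (Fintype.card K - 1) d (y.1 * y0.1⁻¹)) =
        ∑ a : {a : Fin s → ZMod (Fintype.card K - 1) // ∑ j, a j = (d : ZMod _)},
          ((auxChi a.1 (y0.1⁻¹) : Kˣ) : K) • fun y : Y => ((auxChi a.1 y.1 : Kˣ) : K) := by
      funext y
      simp only [auxF, Finset.sum_apply, Pi.smul_apply, smul_eq_mul]
      refine Finset.sum_congr rfl fun a _ => ?_
      rw [auxChi_mul, mul_comm]; simp
    rw [this]
    refine Submodule.sum_mem _ fun a _ => Submodule.smul_mem _ _ (Submodule.subset_span ?_)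
    obtain ⟨b, hb, hb'⟩ := H a.1 a.2
    refine ⟨monomial (Finsupp.equivFunOnFinite.symm b) 1, ?_, ?_⟩
    · apply isHomogeneous_monomial
      rw [Finsupp.degree_eq_sum]
      simpa using hb
    · funext y
      rw [← hb' y.1 y.2, eval_monomial, Finsupp.prod_fintype _ _ (by simp)]
      simp
  have hbij : Function.Bijective (R.domRestrict V) := by
    constructor
    · rw [injective_iff_map_eq_zero]
      rintro ⟨g, hg⟩ h
      ext y
      have h1 := congrFun h ⟨_, Set.mem_image_of_mem _ y.2⟩
      have h2 := hσ ⟨_, Set.mem_image_of_mem _ y.2⟩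
      set y' := σ ⟨_, Set.mem_image_of_mem _ y.2⟩ with hy'
      simp only at h2
      rw [QuotientGroup.eq] at h2
      obtain ⟨l, hl⟩ := h2
      have h3 := hhom g hg y' y l (fun i => by
        have := congrFun hl i
        simp only [Pi.mul_apply, Pi.inv_apply] at this
        rw [← this]; simp)
      have h4 : g y' = 0 := h1
      simp [h3, h4]
    · intro f
      have hF1 := auxF_one (K := K) (s := s) d hs
      refine ⟨∑ t : T, (f t * (auxF (K := K) (s := s) (Fintype.card K - 1) d 1)⁻¹) •
        (⟨_, hFmem (σ t)⟩ : V), ?_⟩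
      funext t'
      rw [map_sum, Finset.sum_apply, Finset.sum_eq_single t']
      · simp [R, LinearMap.funLeft_apply, hF1]
      · intro t _ ht
        have hex : ∃ i j, (σ t').1 i * ((σ t).1 i)⁻¹ ≠ (σ t').1 j * ((σ t).1 j)⁻¹ := by
          by_contra! hcon
          apply ht
          apply Subtype.ext
          rw [← hσ, ← hσ, QuotientGroup.eq]
          refine ⟨(σ t').1 ⟨0, hs⟩ * ((σ t).1 ⟨0, hs⟩)⁻¹, ?_⟩
          funext i
          rw [← hcon i]
          simp [mul_comm]
        obtain ⟨i, j, hij⟩ := hex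
        have := auxF_zero d hN ((σ t').1 * ((σ t).1)⁻¹) i j hij
        simp [R, LinearMap.funLeft_apply, this]
      · simp
  rw [(LinearEquiv.ofBijective _ hbij).finrank_eq, Module.finrank_fintype_fun_eq_card,
    Nat.card_eq_fintype_card]

lemma aux_telescope {V A : Type} [AddCommGroup A] {G : SimpleGraph V} (h : V → A) {u v : V}
    (w : G.Walk u v) : (w.darts.map fun d => h d.fst - h d.snd).sum = h u - h v := by
  induction w with
  | nil => simp
  | cons hadj p ih => simp [ih]

lemma aux_cycle {n s : ℕ} (e : Fin s → Sym2 (Fin n)) (he : Function.Injective e)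
    (G : SimpleGraph (Fin n)) (hbip : G.Colorable 2) (E : Finset (Fin s))
    (hcyc : ∃ (v : Fin n) (w : G.Walk v v), w.IsCycle ∧
      {x : Sym2 (Fin n) | x ∈ w.edges} = e '' ↑E) :
    ∃ ε : Fin s → ℤ, (∀ j ∈ E, ε j = 1 ∨ ε j = -1) ∧ (∀ j ∉ E, ε j = 0) ∧ ∑ j, ε j = 0 ∧
      ∀ (M : Type) [CommGroup M] (x : Fin n → M), ∏ j, edgeProd x (e j) ^ ε j = 1 := by
  classical
  obtain ⟨v, w, hw, hE⟩ := hcyc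
  obtain ⟨C⟩ := hbip
  let χ : Fin n → ℤ := fun v => if C v = 0 then 1 else -1
  have hχ : ∀ v, χ v = 1 ∨ χ v = -1 := by intro v; simp only [χ]; split_ifs <;> simp
  have hadj : ∀ u v, G.Adj u v → χ v = - χ u := by
    intro u v h
    have := C.valid h
    simp only [χ]
    split_ifs with h1 h2 h2
    · exact absurd (h2.trans h1.symm) this
    · simp
    · simp
    · exact absurd (by omega) this
  have hD : ∀ j, ∃ d : Option G.Dart, (j ∈ E → ∃ d', d = some d' ∧ d' ∈ w.darts ∧ d'.edge = e j) := by
    intro j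
    by_cases hj : j ∈ E
    · have : e j ∈ {x : Sym2 (Fin n) | x ∈ w.edges} := by rw [hE]; exact ⟨j, hj, rfl⟩
      simp only [SimpleGraph.Walk.edges, List.mem_map, Set.mem_ofPred_eq] at this
      obtain ⟨d, hd, hd'⟩ := this
      exact ⟨some d, fun _ => ⟨d, rfl, hd, hd'⟩⟩
    · exact ⟨none, fun h => absurd h hj⟩
  have hD' : ∀ j : E, ∃ d : G.Dart, d ∈ w.darts ∧ d.edge = e j := by
    rintro ⟨j, hj⟩
    obtain ⟨d, hd⟩ := hD j
    obtain ⟨d', -, h1, h2⟩ := hd hj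
    exact ⟨d', h1, h2⟩
  choose D hDm hDe using hD'
  have hnod : (w.darts.map SimpleGraph.Dart.edge).Nodup := hw.isTrail.edges_nodup
  have hsum : ∀ (A : Type) [AddCommMonoid A] (φ : G.Dart → A),
      ∑ j : E, φ (D j) = (w.darts.map φ).sum := by
    intro A _ φ
    rw [← List.sum_toFinset φ hnod.of_map]
    refine Finset.sum_bij (fun j _ => D j) ?_ ?_ ?_ ?_
    · intro j _; simpa using hDm j
    · intro j _ j' _ h
      apply Subtype.ext
      apply he
      rw [← hDe, ← hDe, h]
    · intro d hd
      have hd1 : d ∈ w.darts := by simpa using hd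
      have : d.edge ∈ e '' ↑E := by
        rw [← hE]; exact List.mem_map_of_mem hd1
      obtain ⟨j, hj, hje⟩ := this
      refine ⟨⟨j, hj⟩, Finset.mem_univ _, ?_⟩
      exact List.inj_on_of_nodup_map hnod (hDm _) hd1 (by rw [hDe, hje])
    · intros; rfl
  have htel : ∀ (A : Type) [AddCommGroup A] (h : Fin n → A),
      ∑ j : E, (h (D j).fst - h (D j).snd) = 0 := by
    intro A _ h
    rw [hsum A (fun d => h d.fst - h d.snd), aux_telescope, sub_self]
  refine ⟨fun j => if hj : j ∈ E then χ (D ⟨j, hj⟩).fst else 0, ?_, ?_, ?_, ?_⟩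
  · intro j hj; simp only [hj, dif_pos]; exact hχ _
  · intro j hj; simp [hj]
  · have h1 := htel ℤ χ
    have h2 : ∑ j : E, (χ (D j).fst - χ (D j).snd) = 2 * ∑ j : E, χ (D j).fst := by
      rw [Finset.mul_sum]
      refine Finset.sum_congr rfl fun j _ => ?_
      rw [hadj _ _ (D j).adj]; ring
    have h3 : ∑ j, (if hj : j ∈ E then χ (D ⟨j, hj⟩).fst else 0) = ∑ j : E, χ (D j).fst := by
      rw [← Finset.sum_subset (Finset.subset_univ E) (by intro j _ hj; simp [hj]),
        ← Finset.sum_coe_sort E]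
      refine Finset.sum_congr rfl fun j _ => ?_
      simp
    rw [h3]; omega
  · intro M _ x
    have h1 := htel (Additive M) (fun v => Additive.ofMul (x v ^ χ v))
    have h1' : ∏ j : E, (x (D j).fst ^ χ (D j).fst / x (D j).snd ^ χ (D j).snd) = 1 := h1
    rw [← h1', ← Finset.prod_subset (Finset.subset_univ E) (by intro j _ hj; simp [hj]),
        ← Finset.prod_coe_sort E]
    refine Finset.prod_congr rfl fun j _ => ?_
    simp only [j.2, dif_pos]
    rw [hadj _ _ (D j).adj, ← hDe]
    have : edgeProd x (D j).edge = x (D j).fst * x (D j).snd := rfl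
    rw [this, mul_zpow]
    simp

lemma aux_avg {s N : ℕ} [NeZero N] (a : Fin s → ZMod N) (E : Finset (Fin s)) (k : ℕ)
    (hk : E.card = 2 * k) (ε : Fin s → ℤ) (hε : ∀ j ∈ E, ε j = 1 ∨ ε j = -1) :
    ∃ c : ZMod N, ∑ j ∈ E, (a j + c * (ε j : ZMod N)).val ≤ k * (N - 1) := by
  have hval : ∑ c : ZMod N, c.val * 2 = N * (N - 1) := by
    rw [← Finset.sum_mul, ← Finset.sum_range_id_mul_two]
    congr 1
    refine Finset.sum_bij (fun c _ => c.val) ?_ ?_ ?_ ?_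
    · intro c _; simpa using ZMod.val_lt c
    · intro c _ c' _ h; exact ZMod.val_injective N h
    · intro b hb
      exact ⟨(b : ZMod N), Finset.mem_univ _, ZMod.val_cast_of_lt (by simpa using hb)⟩
    · intros; rfl
  have hone : ∀ j ∈ E, ∑ c : ZMod N, (a j + c * (ε j : ZMod N)).val = ∑ c : ZMod N, c.val := by
    intro j hj
    rcases hε j hj with h | h
    · rw [h]; simpa using Equiv.sum_comp (Equiv.addLeft (a j)) (fun c : ZMod N => c.val)
    · rw [h]
      simpa [sub_eq_add_neg] using Equiv.sum_comp (Equiv.subLeft (a j)) (fun c : ZMod N => c.val)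
  by_contra! hcon
  have h1 : ∑ c : ZMod N, (k * (N - 1)) < ∑ c : ZMod N, ∑ j ∈ E, (a j + c * (ε j : ZMod N)).val :=
    Finset.sum_lt_sum_of_nonempty Finset.univ_nonempty (fun c _ => hcon c)
  rw [Finset.sum_comm, Finset.sum_congr rfl hone] at h1
  simp only [Finset.sum_const, Finset.card_univ, ZMod.card, hk, smul_eq_mul] at h1
  rw [← Finset.sum_mul] at hval
  have : 2 * k * ∑ c : ZMod N, c.val = k * (N * (N - 1)) := by rw [← hval]; ring
  rw [this] at h1
  exact absurd h1 (by rw [mul_left_comm]; exact lt_irrefl _)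

/-- Let `G` be a bipartite simple graph (not necessarily connected) with
`s ≥ 2` edges and no isolated vertices, and let `H_1,…,H_m` be cycle subgraphs of `G` of
lengths `2k_1,…,2k_m` with pairwise disjoint edge sets.  Then `H_X(d) = |X|` for every
`d ≥ (q−2)(s − (k_1+⋯+k_m) − 1)`; that is, the regularity of `S/I(X)` is at most
`(q−2)(s − Σ k_i − 1)`. -/
theorem regularity_bound_bipartite
    (q n s m : ℕ) (hq : 2 < q) (hs : 2 ≤ s) (K : Type) [Field K] [Fintype K]
    (hcard : Fintype.card K = q)
    (e : Fin s → Sym2 (Fin n)) (he : Function.Injective e)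
    (hnd : ∀ i, ¬ (e i).IsDiag)
    (hiso : ∀ v : Fin n, ∃ i, v ∈ e i)
    (G : SimpleGraph (Fin n)) (hG : G = SimpleGraph.fromEdgeSet (Set.range e))
    (hbip : G.Colorable 2)
    (E : Fin m → Finset (Fin s)) (kk : Fin m → ℕ)
    -- each `H_i` is a cycle subgraph of `G`, with edge set `{e j : j ∈ E i}`
    (hcyc : ∀ i : Fin m, ∃ (v : Fin n) (w : G.Walk v v), w.IsCycle ∧
      {x : Sym2 (Fin n) | x ∈ w.edges} = e '' ↑(E i))
    -- `H_i` has length `2 k_i`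
    (hlen : ∀ i : Fin m, (E i).card = 2 * kk i)
    -- the edge sets of the `H_i` are pairwise disjoint
    (hdisjE : ∀ i₁ i₂ : Fin m, i₁ ≠ i₂ → Disjoint (E i₁) (E i₂)) :
    ∀ d : ℕ, (q - 2) * (s - (∑ i, kk i) - 1) ≤ d →
      hilbertFn K (graphXstar K e) d = XCard K (graphXstar K e) := by
  classical
  intro d hd
  have hN : 1 < Fintype.card K - 1 := by omega
  have : NeZero (Fintype.card K - 1) := ⟨by omega⟩
  apply aux_dim _ d (by omega) hN
  intro a ha
  have hq2 : q - 2 = (Fintype.card K - 1) - 1 := by omega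
  rw [hq2] at hd
  generalize hNN : Fintype.card K - 1 = N at *
  choose ε hε1 hε0 hεs hεp using fun i => aux_cycle e he G hbip (E i) (hcyc i)
  choose c hc using fun i => aux_avg a (E i) (kk i) (hlen i) (ε i) (hε1 i)
  let a' : Fin s → ZMod N := fun j => a j + ∑ i, c i * (ε i j : ZMod N)
  have ha'1 : ∀ i, ∀ j ∈ E i, a' j = a j + c i * (ε i j : ZMod N) := by
    intro i j hj
    simp only [a']
    rw [Finset.sum_eq_single i]
    · intro i' _ hi'
      rw [hε0 i' j (fun h => Finset.disjoint_left.mp (hdisjE i' i hi') h hj)]; simp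
    · simp
  have ha's : ∑ j, a' j = (d : ZMod N) := by
    simp only [a']
    rw [Finset.sum_add_distrib, ha, Finset.sum_comm]
    have : ∀ i, ∑ j, c i * (ε i j : ZMod N) = 0 := by
      intro i
      rw [← Finset.mul_sum, ← Int.cast_sum, hεs]; simp
    simp [this]
  have hchi : ∀ y ∈ graphXstar K e, auxChi a' y = auxChi a y := by
    rintro _ ⟨x, rfl⟩
    unfold auxChi
    simp only
    have h1 : ∀ j, edgeProd x (e j) ^ (a' j).val =
        edgeProd x (e j) ^ (a j).val * ∏ i, (edgeProd x (e j) ^ ε i j) ^ (c i).val := by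
      intro j
      have h2 : ∏ i, (edgeProd x (e j) ^ ε i j) ^ (c i).val
          = edgeProd x (e j) ^ (∑ i, ε i j * ((c i).val : ℤ)) := by
        rw [Finset.prod_congr rfl (g := fun i => edgeProd x (e j) ^ (ε i j * ((c i).val : ℤ)))]
        · induction (Finset.univ : Finset (Fin m)) using Finset.induction_on with
          | empty => simp
          | insert i t hi ih => rw [Finset.prod_insert hi, Finset.sum_insert hi, zpow_add, ih]
        · intro i _; rw [zpow_mul, zpow_natCast]
      rw [h2, ← zpow_natCast, ← zpow_natCast, ← zpow_add]
      apply aux_pow_congr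
      rw [hNN]
      simp [a', mul_comm]
    rw [Finset.prod_congr rfl (fun j _ => h1 j), Finset.prod_mul_distrib, Finset.prod_comm]
    simp only [Finset.prod_pow, hεp, one_pow, Finset.prod_const_one, mul_one]
  -- degree bound
  set U := Finset.univ.biUnion E with hU
  have hpd : (↑(Finset.univ : Finset (Fin m)) : Set (Fin m)).PairwiseDisjoint E :=
    fun i _ i' _ h => hdisjE i i' h
  have hUc : U.card = 2 * ∑ i, kk i := by
    rw [hU, Finset.card_biUnion hpd, Finset.mul_sum]
    exact Finset.sum_congr rfl fun i _ => hlen i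
  have hUs : U.card + Uᶜ.card = s := by simpa using Finset.card_add_card_compl U
  have hb1 : ∑ j ∈ U, (a' j).val ≤ (∑ i, kk i) * (N - 1) := by
    rw [hU, Finset.sum_biUnion hpd, Finset.sum_mul]
    refine Finset.sum_le_sum fun i _ => le_trans (le_of_eq ?_) (hc i)
    exact Finset.sum_congr rfl fun j hj => by rw [ha'1 i j hj]
  have hb2 : ∑ j ∈ Uᶜ, (a' j).val ≤ Uᶜ.card * (N - 1) := by
    rw [← smul_eq_mul]
    exact Finset.sum_le_card_nsmul _ _ _ fun j _ => by have := ZMod.val_lt (a' j); omega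
  have hb : ∑ j, (a' j).val ≤ (N - 1) * (s - (∑ i, kk i) - 1) + (N - 1) := by
    rw [← Finset.sum_add_sum_compl U]
    refine (add_le_add hb1 hb2).trans (le_of_eq ?_)
    rw [← Nat.mul_succ, ← add_mul, mul_comm]
    congr 1
    omega
  have hmod : ∑ j, (a' j).val ≡ d [MOD N] := by
    rw [← ZMod.natCast_eq_natCast_iff, ← ha's]
    simp
  have hle : ∑ j, (a' j).val ≤ d := by
    by_contra! hlt
    have := (Nat.modEq_iff_dvd' hlt.le).mp hmod.symm
    have := Nat.le_of_dvd (by omega) this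
    omega
  obtain ⟨t, ht⟩ := (Nat.modEq_iff_dvd' hle).mp hmod
  let i0 : Fin s := ⟨0, by omega⟩
  refine ⟨fun j => (a' j).val + if j = i0 then N * t else 0, ?_, ?_⟩
  · rw [Finset.sum_add_distrib]
    simp only [Finset.sum_ite_eq', Finset.mem_univ, if_true]
    omega
  · intro y hy
    rw [← hchi y hy]
    unfold auxChi
    refine Finset.prod_congr rfl fun j _ => ?_
    rw [← zpow_natCast, ← zpow_natCast]
    apply aux_pow_congr
    rw [hNN]
    beta_reduce
    split_ifs <;> simp
end
end

section
/- Let G be a connected bipartite simple graph with s ≥ 2 edges, and suppose H_1,…,H_m are cycle subgraphs of G of lengths 2k_1,…,2k_m with pairwise disjoint vertex sets such that every cycle of G coincides with one of H_1,…,H_m. Set ℓ = (q−2)·(s − (k_1+⋯+k_m) − 1). Then H_X(d) = |X| for every integer d ≥ ℓ and H_X(ℓ−1) < |X|; that is, the regularity of S/I(X), namely the least nonnegative integer ℓ₀ such that H_X(d) = |X| for all d ≥ ℓ₀, equals (q−2)(s − Σ_{i=1}^m k_i − 1). -/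
open MvPolynomial

noncomputable section

/-- The incidence operator of the graph with edges `{U j, V j}`. -/
def incOp {R : Type} [CommRing R] {n s : ℕ} (U V : Fin s → Fin n) (a : Fin s → R) (v : Fin n) : R :=
  ∑ j, ((if U j = v then a j else 0) + (if V j = v then a j else 0))

lemma incOp_add {R : Type} [CommRing R] {n s : ℕ} (U V : Fin s → Fin n) (a b : Fin s → R)
    (v : Fin n) : incOp U V (fun j => a j + b j) v = incOp U V a v + incOp U V b v := by
  unfold incOp
  rw [← Finset.sum_add_distrib]
  refine Finset.sum_congr rfl fun j _ => ?_
  split_ifs <;> ring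

lemma incOp_smul {R : Type} [CommRing R] {n s : ℕ} (U V : Fin s → Fin n) (r : R) (b : Fin s → R)
    (v : Fin n) : incOp U V (fun j => r * b j) v = r * incOp U V b v := by
  unfold incOp
  rw [Finset.mul_sum]
  refine Finset.sum_congr rfl fun j _ => ?_
  split_ifs <;> ring

lemma sum_incOp {R : Type} [CommRing R] {n s : ℕ} (U V : Fin s → Fin n) (a : Fin s → R)
    (w : Fin n → R) : ∑ v, w v * incOp U V a v = ∑ j, a j * (w (U j) + w (V j)) := by
  unfold incOp
  simp_rw [Finset.mul_sum]
  rw [Finset.sum_comm]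
  refine Finset.sum_congr rfl fun j _ => ?_
  simp [mul_add, Finset.sum_add_distrib]
  ring

lemma two_mul_sum_val (N : ℕ) [NeZero N] : 2 * ∑ x : ZMod N, x.val = N * (N - 1) := by
  obtain ⟨k, rfl⟩ := Nat.exists_eq_succ_of_ne_zero (NeZero.ne N)
  change 2 * ∑ x : Fin (k+1), (x : ℕ) = _
  rw [Fin.sum_univ_eq_sum_range (fun i => i), mul_comm, Finset.sum_range_id_mul_two]

lemma two_mul_sum_shift (N : ℕ) [NeZero N] (b c : ZMod N) (hc : c = 1 ∨ c = -1) :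
    2 * ∑ x : ZMod N, (b + x * c).val = N * (N - 1) := by
  rw [← two_mul_sum_val N]
  congr 1
  rcases hc with rfl | rfl
  · simpa using Equiv.sum_comp (Equiv.addLeft b) (fun x : ZMod N => x.val)
  · simpa [sub_eq_add_neg] using Equiv.sum_comp (Equiv.subLeft b) (fun x : ZMod N => x.val)

/-- Upper bound: every class has a representative of small weight. -/
lemma upper_rep {n s m : ℕ} (N : ℕ) [NeZero N] (U V : Fin s → Fin n)
    (E : Fin m → Finset (Fin s)) (kk : Fin m → ℕ) (hlen : ∀ i, (E i).card = 2 * kk i)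
    (hE : ∀ i₁ i₂, i₁ ≠ i₂ → Disjoint (E i₁) (E i₂))
    (c : Fin m → Fin s → ZMod N) (hc1 : ∀ i, ∀ j ∈ E i, c i j = 1 ∨ c i j = -1)
    (hc0 : ∀ i, ∀ j ∉ E i, c i j = 0) (hcA : ∀ i v, incOp U V (c i) v = 0)
    (a : Fin s → ZMod N) :
    ∃ b : Fin s → ZMod N, (∀ v, incOp U V b v = incOp U V a v) ∧
      ∑ j, (b j).val ≤ (N - 1) * (s - ∑ i, kk i) := by
  classical
  obtain ⟨b, hb, hmin⟩ := Set.exists_min_image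
    {b : Fin s → ZMod N | ∀ v, incOp U V b v = incOp U V a v} (fun b => ∑ j, (b j).val)
    (Set.toFinite _) ⟨a, fun _ => rfl⟩
  refine ⟨b, hb, ?_⟩
  have key : ∀ i, ∑ j ∈ E i, (b j).val ≤ kk i * (N - 1) := by
    intro i
    have h1 : ∀ x : ZMod N, ∑ j ∈ E i, (b j).val ≤ ∑ j ∈ E i, (b j + x * c i j).val := by
      intro x
      have := hmin (fun j => b j + x * c i j) (by
        intro v
        rw [incOp_add, incOp_smul, hcA, mul_zero, add_zero, hb v])
      beta_reduce at this
      rw [← Finset.sum_add_sum_compl (E i), ← Finset.sum_add_sum_compl (E i) (fun j => (b j + x * c i j).val)] at this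
      have h2 : ∑ j ∈ (E i)ᶜ, (b j + x * c i j).val = ∑ j ∈ (E i)ᶜ, (b j).val := by
        refine Finset.sum_congr rfl fun j hj => ?_
        rw [hc0 i j (by simpa using hj)]; simp
      omega
    have h3 : ∑ x : ZMod N, ∑ j ∈ E i, (b j).val ≤ ∑ x : ZMod N, ∑ j ∈ E i, (b j + x * c i j).val :=
      Finset.sum_le_sum fun x _ => h1 x
    rw [Finset.sum_comm (s := Finset.univ) (t := E i) (f := fun x j => (b j + x * c i j).val)] at h3
    have h4 : 2 * ∑ j ∈ E i, ∑ x : ZMod N, (b j + x * c i j).val = 2 * kk i * (N * (N - 1)) := by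
      rw [Finset.mul_sum, ← hlen i, ← smul_eq_mul, ← Finset.sum_const]
      exact Finset.sum_congr rfl fun j hj => two_mul_sum_shift N _ _ (hc1 i j hj)
    simp only [Finset.sum_const, Finset.card_univ, ZMod.card, smul_eq_mul] at h3
    have hN : 0 < N := Nat.pos_of_ne_zero (NeZero.ne N)
    refine Nat.le_of_mul_le_mul_left (c := N) ?_ hN
    calc N * ∑ j ∈ E i, (b j).val ≤ ∑ j ∈ E i, ∑ x : ZMod N, (b j + x * c i j).val := h3
      _ = kk i * (N * (N - 1)) := by
        rw [mul_assoc] at h4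
        exact Nat.eq_of_mul_eq_mul_left (by norm_num) h4
      _ = _ := by ring
  have hpd : (↑(Finset.univ : Finset (Fin m)) : Set (Fin m)).PairwiseDisjoint E :=
    fun i _ j _ hij => hE i j hij
  set F := Finset.univ.biUnion E with hF
  have hFc : F.card = 2 * ∑ i, kk i := by
    rw [hF, Finset.card_biUnion fun i _ j _ hij => hE i j hij, Finset.mul_sum]
    exact Finset.sum_congr rfl fun i _ => hlen i
  have hFs : ∑ j ∈ F, (b j).val ≤ (∑ i, kk i) * (N - 1) := by
    rw [hF, Finset.sum_biUnion hpd, Finset.sum_mul]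
    exact Finset.sum_le_sum fun i _ => key i
  have hFle : F.card ≤ s := by simpa using Finset.card_le_univ F
  have hcs : ∑ j ∈ Fᶜ, (b j).val ≤ (s - 2 * ∑ i, kk i) * (N - 1) := by
    have : Fᶜ.card = s - 2 * ∑ i, kk i := by rw [Finset.card_compl, hFc]; simp
    rw [← this, ← smul_eq_mul, ← Finset.sum_const]
    refine Finset.sum_le_sum fun j _ => ?_
    have := ZMod.val_lt (b j)
    omega
  rw [← Finset.sum_add_sum_compl F]
  calc _ ≤ (∑ i, kk i) * (N - 1) + (s - 2 * ∑ i, kk i) * (N - 1) := add_le_add hFs hcs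
    _ = (N - 1) * (s - ∑ i, kk i) := by
      rw [← add_mul, mul_comm]; congr 1; omega

/-- Lower bound: there is a class all of whose representatives have large weight. -/
lemma lower_rep {n s k : ℕ} (N : ℕ) [NeZero N] (U V : Fin s → Fin n)
    (F : Finset (Fin s)) (hF : F.card = 2 * k)
    (hUV : ∀ i j, U i ≠ V j)
    (hker : ∀ κ : Fin s → ZMod N, (∀ v, incOp U V κ v = 0) → ∀ j ∉ F, κ j = 0)
    (h2 : ∀ j ∈ F, (F.filter (fun i => U i = U j)).card = 2) :
    ∃ b : Fin s → ℕ, ∑ j, b j = (N - 1) * (s - k) ∧ ∀ a : Fin s → ℕ,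
      (∀ v, incOp U V (fun j => (a j : ZMod N)) v = incOp U V (fun j => (b j : ZMod N)) v) →
      (N - 1) * (s - k) ≤ ∑ j, a j := by
  classical
  have hN : 0 < N := Nat.pos_of_ne_zero (NeZero.ne N)
  have hch : ∀ v : Fin n, ∃ h : Option (Fin s), v ∈ F.image U → ∃ j ∈ F, h = some j ∧ U j = v := by
    intro v
    by_cases hv : v ∈ F.image U
    · obtain ⟨j, hj, rfl⟩ := Finset.mem_image.1 hv
      exact ⟨some j, fun _ => ⟨j, hj, rfl, rfl⟩⟩
    · exact ⟨none, fun h => absurd h hv⟩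
  choose h hh using hch
  set b : Fin s → ℕ := fun j => if j ∉ F ∨ h (U j) = some j then N - 1 else 0 with hb
  have hW : (F.image U).card = k := by
    have := Finset.card_eq_sum_card_image U F
    rw [Finset.sum_congr rfl (g := fun _ => 2), Finset.sum_const, hF, smul_eq_mul] at this
    · omega
    · intro v hv
      obtain ⟨j, hj, rfl⟩ := Finset.mem_image.1 hv
      exact h2 j hj
  have hFle : F.card ≤ s := by simpa using Finset.card_le_univ F
  have hcc : Fᶜ.card = s - 2 * k := by rw [Finset.card_compl, hF]; simp
  have harith : (s - 2 * k) * (N - 1) + k * (N - 1) = (N - 1) * (s - k) := by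
    rw [← add_mul, mul_comm]; congr 1; omega
  have split : ∀ f : Fin s → ℕ, ∑ j, f j = ∑ j ∈ Fᶜ, f j +
      ∑ v ∈ F.image U, ∑ j ∈ F with U j = v, f j := by
    intro f
    rw [Finset.sum_fiberwise_of_maps_to (s := F) (g := U) (t := F.image U)
      (fun j hj => Finset.mem_image_of_mem U hj), add_comm, Finset.sum_add_sum_compl]
  have hbv : ∀ v ∈ F.image U, ∑ j ∈ F with U j = v, b j = N - 1 := by
    intro v hv
    obtain ⟨j, hj, hjs, hjv⟩ := hh v hv
    rw [Finset.sum_eq_single j]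
    · simp [hb, hjv, hjs]
    · intro i hi hij
      simp only [Finset.mem_filter] at hi
      have : h (U i) ≠ some i := by
        rw [hi.2, hjs]; intro h'; exact hij (Option.some.inj h').symm
      simp [hb, hi.1, this]
    · intro h'; exact absurd (by simp [hj, hjv]) h'
  refine ⟨b, ?_, ?_⟩
  · rw [split, Finset.sum_congr rfl hbv, Finset.sum_const, hW, ← harith, smul_eq_mul]
    congr 1
    rw [← hcc, ← smul_eq_mul, ← Finset.sum_const]
    refine Finset.sum_congr rfl fun j hj => ?_
    simp [hb, Finset.mem_compl.1 hj]
  · intro a ha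
    have hmod : ∀ x : ℕ, (x : ZMod N) = ((N - 1 : ℕ) : ZMod N) → N - 1 ≤ x := by
      intro x hx
      rw [ZMod.natCast_eq_natCast_iff', Nat.mod_eq_of_lt (by omega : N - 1 < N)] at hx
      rw [← hx]; exact Nat.mod_le _ _
    set κ : Fin s → ZMod N := fun j => (a j : ZMod N) + (-1) * (b j : ZMod N) with hκ
    have hκ0 : ∀ v, incOp U V κ v = 0 := by
      intro v
      rw [hκ, incOp_add, incOp_smul, ha]; ring
    have hout := hker κ hκ0
    rw [split, ← harith]
    refine add_le_add ?_ ?_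
    · rw [← hcc, ← smul_eq_mul, ← Finset.sum_const]
      refine Finset.sum_le_sum fun j hj => hmod _ ?_
      have := hout j (Finset.mem_compl.1 hj)
      simp only [hκ, hb, Finset.mem_compl.1 hj, not_false_eq_true, true_or, if_true] at this
      linear_combination this
    · rw [← hW, ← smul_eq_mul, ← Finset.sum_const]
      refine Finset.sum_le_sum fun v hv => hmod _ ?_
      rw [← hbv v hv]
      have h0 := hκ0 v
      obtain ⟨j0, hj0, rfl⟩ := Finset.mem_image.1 hv
      have h5 : incOp U V κ (U j0) = ∑ j ∈ F with U j = U j0, κ j := by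
        unfold incOp
        rw [Finset.sum_filter, ← Finset.sum_add_sum_compl F]
        rw [Finset.sum_eq_zero (s := Fᶜ), add_zero]
        · refine Finset.sum_congr rfl fun j _ => ?_
          simp [(hUV j0 j).symm]
        · intro j hj
          simp [hout j (Finset.mem_compl.1 hj)]
      rw [h5] at h0
      simp only [hκ, Finset.sum_add_distrib, ← Finset.mul_sum] at h0
      push_cast
      linear_combination h0

lemma incOp_single {R : Type} [CommRing R] {n s : ℕ} (U V : Fin s → Fin n)
    (e : Fin s → Sym2 (Fin n)) (he : Function.Injective e) (heUV : ∀ j, e j = s(U j, V j))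
    (u w : Fin n) (huw : s(u, w) ∈ Set.range e) (r : R) (v : Fin n) :
    incOp U V (fun j => if s(u, w) = e j then r else 0) v =
      (if u = v then r else 0) + (if w = v then r else 0) := by
  obtain ⟨j0, hj0⟩ := huw
  unfold incOp
  rw [Finset.sum_eq_single j0]
  · beta_reduce
    rw [if_pos hj0.symm]
    rw [heUV, Sym2.eq_iff] at hj0
    rcases hj0 with ⟨rfl, rfl⟩ | ⟨rfl, rfl⟩
    · rfl
    · rw [add_comm]
  · intro j _ hj
    have : s(u, w) ≠ e j := by
      rw [← hj0]; intro h; exact hj (he h).symm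
    simp [this]
  · simp

/-- The signed edge vector of a walk. -/
def walkVec {R : Type} [CommRing R] {n s : ℕ} (e : Fin s → Sym2 (Fin n)) (ε : Fin n → R)
    {G : SimpleGraph (Fin n)} : {u v : Fin n} → G.Walk u v → Fin s → R
  | _, _, SimpleGraph.Walk.nil => fun _ => 0
  | u, _, SimpleGraph.Walk.cons (v := w) _ p =>
      fun j => (if s(u, w) = e j then ε u else 0) + walkVec e ε p j

lemma walkVec_incOp {R : Type} [CommRing R] {n s : ℕ} (U V : Fin s → Fin n)
    (e : Fin s → Sym2 (Fin n)) (he : Function.Injective e) (heUV : ∀ j, e j = s(U j, V j))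
    (ε : Fin n → R) (G : SimpleGraph (Fin n)) (hG : ∀ u w, G.Adj u w → s(u, w) ∈ Set.range e)
    (hε : ∀ u w, G.Adj u w → ε w = - ε u) {u w : Fin n} (p : G.Walk u w) (v : Fin n) :
    incOp U V (walkVec e ε p) v = (if u = v then ε v else 0) - (if w = v then ε v else 0) := by
  induction p with
  | nil => simp [walkVec, incOp]
  | cons h p ih =>
    rename_i a b c
    simp only [walkVec]
    rw [incOp_add, ih, incOp_single U V e he heUV _ _ (hG _ _ h)]
    have := hε _ _ h
    by_cases h1 : a = v <;> by_cases h2 : b = v <;> by_cases h3 : c = v <;> simp_all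

lemma walkVec_not_mem {R : Type} [CommRing R] {n s : ℕ} 
    (e : Fin s → Sym2 (Fin n)) (ε : Fin n → R) (G : SimpleGraph (Fin n))
    {u w : Fin n} (p : G.Walk u w) (j : Fin s) (hj : e j ∉ p.edges) : walkVec e ε p j = 0 := by
  induction p with
  | nil => simp [walkVec]
  | cons h p ih =>
    simp only [SimpleGraph.Walk.edges_cons, List.mem_cons, not_or] at hj
    simp [walkVec, ih hj.2, Ne.symm hj.1]

lemma walkVec_mem {R : Type} [CommRing R] {n s : ℕ} 
    (e : Fin s → Sym2 (Fin n)) (ε : Fin n → R) (hε : ∀ u, ε u = 1 ∨ ε u = -1)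
    (G : SimpleGraph (Fin n))
    {u w : Fin n} (p : G.Walk u w) (hp : p.edges.Nodup) (j : Fin s) (hj : e j ∈ p.edges) :
    walkVec e ε p j = 1 ∨ walkVec e ε p j = -1 := by
  induction p with
  | nil => simp at hj
  | cons h p ih =>
    rename_i a b c
    simp only [SimpleGraph.Walk.edges_cons, List.mem_cons, List.nodup_cons] at hj hp
    by_cases h1 : e j = s(a, b)
    · have := walkVec_not_mem e ε G p j (h1 ▸ hp.1)
      simpa [walkVec, this, h1] using hε a
    · simpa [walkVec, Ne.symm h1] using ih hp.2 (hj.resolve_left h1)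

lemma bridge_ker {R : Type} [CommRing R] {n s : ℕ} (U V : Fin s → Fin n)
    (e : Fin s → Sym2 (Fin n)) (he : Function.Injective e) (heUV : ∀ j, e j = s(U j, V j))
    (ε : Fin n → R) (hεU : ∀ j, ε (U j) = 1) (hεV : ∀ j, ε (V j) = -1)
    (G : SimpleGraph (Fin n)) (hG : ∀ j, G.Adj (U j) (V j))
    (κ : Fin s → R) (hκ : ∀ v, incOp U V κ v = 0) (j : Fin s) (hj : G.IsBridge (e j)) :
    κ j = 0 := by
  classical
  rw [heUV, SimpleGraph.isBridge_iff] at hj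
  set R' : Fin n → Prop := fun w => (G.deleteEdges {s(U j, V j)}).Reachable (U j) w with hR'
  have h := sum_incOp U V κ (fun v => if R' v then ε v else 0)
  simp only [hκ, mul_zero, Finset.sum_const_zero] at h
  rw [Finset.sum_eq_single j] at h
  · have h1 : R' (U j) := SimpleGraph.Reachable.refl _
    have h2 : ¬ R' (V j) := hj
    simp [h1, h2, hεU] at h
    exact h.symm
  · intro i _ hij
    have hadj : (G.deleteEdges {s(U j, V j)}).Adj (U i) (V i) := by
      rw [SimpleGraph.deleteEdges_adj]
      refine ⟨hG i, ?_⟩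
      rw [Set.mem_singleton_iff, ← heUV, ← heUV]
      exact fun h => hij (he h)
    have : R' (U i) ↔ R' (V i) :=
      ⟨fun h => h.trans hadj.reachable, fun h => h.trans hadj.symm.reachable⟩
    by_cases h1 : R' (U i)
    · simp [h1, this.1 h1, hεU, hεV]
    · have h2 : ¬ R' (V i) := fun h => h1 (this.2 h)
      simp [h1, h2]
  · simp


/-- The parametrization as a group homomorphism. -/
def thetaHom (K : Type) [Field K] {n s : ℕ} (e : Fin s → Sym2 (Fin n)) :
    (Fin n → Kˣ) →* (Fin s → Kˣ) where
  toFun x := fun i => edgeProd x (e i)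
  map_one' := by
    funext i
    induction h : e i with | _ a b => simp [edgeProd]
  map_mul' x y := by
    funext i
    induction h : e i with | _ a b => simp [edgeProd, h, mul_mul_mul_comm]

/-- Monomial characters of the big torus. -/
def monChar (K : Type) [Field K] {s : ℕ} (a : Fin s → ℕ) : (Fin s → Kˣ) →* Kˣ where
  toFun y := ∏ j, y j ^ a j
  map_one' := by simp
  map_mul' x y := by simp [mul_pow, Finset.prod_mul_distrib]

/-- Pullbacks of monomial characters. -/
def psi (K : Type) [Field K] {n s : ℕ} (e : Fin s → Sym2 (Fin n)) (a : Fin s → ℕ) :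
    (Fin n → Kˣ) →* Kˣ := (monChar K a).comp (thetaHom K e)

lemma hilbert_eq (K : Type) [Field K] [Fintype K] {n s : ℕ} (e : Fin s → Sym2 (Fin n)) (d : ℕ) :
    hilbertFn K (graphXstar K e) d =
      Set.ncard (psi K e '' {a : Fin s → ℕ | ∑ j, a j = d}) := by
  classical
  set co : ((Fin n → Kˣ) →* Kˣ) → ((Fin n → Kˣ) → K) := fun ψ x => (ψ x : K) with hco
  have hli : LinearIndependent K co := by
    have h := (linearIndependent_monoidHom (Fin n → Kˣ) K).comp
      (fun ψ : (Fin n → Kˣ) →* Kˣ => (Units.coeHom K).comp ψ) (by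
        intro a b hab
        exact MonoidHom.ext fun x => Units.ext (DFunLike.congr_fun hab x))
    exact h
  set C := psi K e '' {a : Fin s → ℕ | ∑ j, a j = d} with hC
  let pr : (Fin n → Kˣ) → graphXstar K e := fun x => ⟨thetaHom K e x, x, rfl⟩
  have hpr : Function.Surjective pr := by
    rintro ⟨_, x, rfl⟩
    exact ⟨x, rfl⟩
  let T : (graphXstar K e → K) →ₗ[K] ((Fin n → Kˣ) → K) := LinearMap.funLeft K K pr
  have hT : Function.Injective T := LinearMap.funLeft_injective_of_surjective K K pr hpr
  unfold hilbertFn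
  rw [(Submodule.equivMapOfInjective T hT _).finrank_eq, Submodule.map_span]
  have hspan : Submodule.span K (T '' {g : graphXstar K e → K | ∃ f : MvPolynomial (Fin s) K,
      f.IsHomogeneous d ∧ g = fun y => eval (fun i => ((y.1 i : Kˣ) : K)) f}) =
      Submodule.span K (co '' C) := by
    apply le_antisymm
    · rw [Submodule.span_le]
      rintro _ ⟨_, ⟨f, hf, rfl⟩, rfl⟩
      have : T (fun y : graphXstar K e => eval (fun i => ((y.1 i : Kˣ) : K)) f) =
          ∑ m ∈ f.support, f.coeff m • co (psi K e m) := by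
        funext x
        simp only [T, LinearMap.funLeft_apply, pr, Finset.sum_apply, Pi.smul_apply, smul_eq_mul]
        rw [eval_eq']
        refine Finset.sum_congr rfl fun m _ => ?_
        simp [hco, psi, monChar]
      rw [this]
      refine Submodule.sum_mem _ fun m hm => Submodule.smul_mem _ _ (Submodule.subset_span ?_)
      refine ⟨_, ⟨m, ?_, rfl⟩, rfl⟩
      have := hf (mem_support_iff.1 hm)
      rw [Finsupp.weight_apply, Finsupp.sum_fintype _ _ (by simp)] at this
      simpa using this
    · rw [Submodule.span_le]
      rintro _ ⟨_, ⟨a, ha, rfl⟩, rfl⟩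
      refine Submodule.subset_span ⟨_, ⟨monomial (Finsupp.equivFunOnFinite.symm a) 1,
        isHomogeneous_monomial _ ?_, rfl⟩, ?_⟩
      · rw [Finsupp.degree_eq_sum]; simpa using ha
      · funext x
        simp only [T, LinearMap.funLeft_apply, pr]
        rw [eval_monomial, Finsupp.prod_fintype _ _ (by simp)]
        simp [hco, psi, monChar]
  rw [hspan]
  have hfin : (co '' C).Finite := by
    have : Finite ((Fin n → Kˣ) →* Kˣ) := DFunLike.finite _
    exact Set.toFinite _
  have := hfin.fintype
  rw [finrank_span_set_eq_card]
  · rw [← Set.ncard_eq_toFinset_card', Set.ncard_image_of_injective _ hli.injective]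
  · exact (hli.linearIndepOn (s := C)).id_image

lemma enough_roots (K : Type) [Field K] [Fintype K] (k : ℕ) (hk : k ∣ Nat.card Kˣ) :
    HasEnoughRootsOfUnity K k := by
  have : NeZero (Nat.card Kˣ) := ⟨Nat.card_pos.ne'⟩
  have : HasEnoughRootsOfUnity K (Nat.card Kˣ) := by
    refine ⟨?_, inferInstance⟩
    obtain ⟨g, hg⟩ := IsCyclic.exists_generator (α := Kˣ)
    refine ⟨g, ?_⟩
    rw [IsPrimitiveRoot.coe_units_iff, ← orderOf_eq_card_of_forall_mem_zpowers hg]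
    exact IsPrimitiveRoot.orderOf g
  exact HasEnoughRootsOfUnity.of_dvd K hk

lemma char_eq_monChar (K : Type) [Field K] [Fintype K] {s : ℕ} (φ : (Fin s → Kˣ) →* Kˣ) :
    ∃ a : Fin s → ℕ, φ = monChar K a := by
  classical
  have h : ∀ j, ∃ a : ℕ, ∀ g : Kˣ, φ (Pi.mulSingle j g) = g ^ a := by
    intro j
    obtain ⟨m, hm⟩ := MonoidHom.map_cyclic (φ.comp (MonoidHom.mulSingle (fun _ : Fin s => Kˣ) j))
    have hN : (0 : ℤ) < Nat.card Kˣ := by exact_mod_cast Nat.card_pos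
    refine ⟨(m % (Nat.card Kˣ : ℤ)).toNat, fun g => ?_⟩
    have := hm g
    simp only [MonoidHom.comp_apply, MonoidHom.mulSingle_apply] at this
    rw [this, ← zpow_natCast, Int.toNat_of_nonneg (Int.emod_nonneg _ hN.ne')]
    exact zpow_eq_zpow_emod' m (by exact pow_card_eq_one')
  choose a ha using h
  refine ⟨a, ?_⟩
  refine MonoidHom.ext fun y => ?_
  have hy := Finset.univ_prod_mulSingle y
  conv_lhs => rw [← hy]
  rw [map_prod]
  simp [monChar, ha]

lemma XCard_eq (K : Type) [Field K] [Fintype K] {n s : ℕ} (hs : 0 < s)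
    (e : Fin s → Sym2 (Fin n)) (d : ℕ) :
    XCard K (graphXstar K e) = Set.ncard (psi K e '' {a : Fin s → ℕ |
      ((∑ j, a j : ℕ) : ZMod (Nat.card Kˣ)) = d}) := by
  classical
  have hN : 0 < Nat.card Kˣ := Nat.card_pos
  have : NeZero (Nat.card Kˣ) := ⟨hN.ne'⟩
  set N := Nat.card Kˣ with hNdef
  have hpowN : ∀ g : Kˣ, g ^ N = 1 := fun g => pow_card_eq_one'
  have hpsi : ∀ a b, psi K e (fun j => a j + b j) = psi K e a * psi K e b := by
    intro a b; ext x; simp [psi, monChar, pow_add, Finset.prod_mul_distrib]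
  have hpsi1 : ∀ a, (∀ j, N ∣ a j) → psi K e a = 1 := by
    intro a ha; ext x
    simp only [psi, monChar, MonoidHom.comp_apply, MonoidHom.coe_mk, OneHom.coe_mk,
      MonoidHom.one_apply]
    rw [Finset.prod_eq_one]
    intro j _
    obtain ⟨c, hc⟩ := ha j
    rw [hc, pow_mul, hpowN, one_pow]
  have hshift : Set.ncard (psi K e '' {a : Fin s → ℕ | ((∑ j, a j : ℕ) : ZMod N) = d}) =
      Set.ncard (psi K e '' {a : Fin s → ℕ | ((∑ j, a j : ℕ) : ZMod N) = 0}) := by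
    set j0 : Fin s := ⟨0, hs⟩
    set t : Fin s → ℕ := fun j => if j = j0 then d else 0 with ht
    have hts : ∑ j, t j = d := by simp [ht]
    have himg : psi K e '' {a : Fin s → ℕ | ((∑ j, a j : ℕ) : ZMod N) = d} =
        (fun ψ => psi K e t * ψ) '' (psi K e '' {a : Fin s → ℕ | ((∑ j, a j : ℕ) : ZMod N) = 0}) := by
      ext ψ
      constructor
      · rintro ⟨a, ha, rfl⟩
        refine ⟨psi K e (fun j => a j + (N - 1) * t j), ⟨_, ?_, rfl⟩, ?_⟩
        · simp only [Set.mem_ofPred_eq] at ha ⊢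
          rw [Finset.sum_add_distrib, ← Finset.mul_sum, hts]
          push_cast [Nat.cast_sub hN] at ha ⊢
          rw [ha]; simp
        · beta_reduce
          rw [← hpsi]
          have : (fun j => t j + (a j + (N - 1) * t j)) = fun j => a j + N * t j := by
            funext j
            obtain ⟨M, hM⟩ : ∃ M, N = M + 1 := ⟨N - 1, by omega⟩
            rw [hM]; simp; ring
          rw [this, hpsi, hpsi1 (fun j => N * t j) (fun j => dvd_mul_right _ _)]
          refine MonoidHom.ext fun x => ?_
          rw [MonoidHom.mul_apply, MonoidHom.one_apply, mul_one]
      · rintro ⟨_, ⟨a, ha, rfl⟩, rfl⟩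
        refine ⟨fun j => t j + a j, ?_, hpsi _ _⟩
        simp only [Set.mem_ofPred_eq] at ha ⊢
        rw [Finset.sum_add_distrib, hts]
        push_cast at ha ⊢
        rw [ha]; simp
    rw [himg, Set.ncard_image_of_injective _ (mul_right_injective _)]
  rw [hshift]
  set f : (Fin n → Kˣ) →* ((Fin s → Kˣ) ⧸ diagSubgroup K s) :=
    (QuotientGroup.mk' (diagSubgroup K s)).comp (thetaHom K e) with hf
  have hset : ((fun y : Fin s → Kˣ =>
      (QuotientGroup.mk y : (Fin s → Kˣ) ⧸ diagSubgroup K s)) '' (graphXstar K e)) =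
      (f.range : Set _) := by
    ext z
    constructor
    · rintro ⟨_, ⟨x, rfl⟩, rfl⟩
      exact ⟨x, rfl⟩
    · rintro ⟨x, rfl⟩
      exact ⟨_, ⟨x, rfl⟩, rfl⟩
  unfold XCard
  rw [hset]
  change Nat.card f.range = _
  have hexp : Monoid.exponent ((Fin s → Kˣ) ⧸ diagSubgroup K s) ∣ N := by
    apply Monoid.exponent_dvd_of_forall_pow_eq_one
    intro z
    induction z using QuotientGroup.induction_on with
    | H y =>
      rw [← QuotientGroup.mk_pow]
      have : y ^ N = 1 := by funext i; exact hpowN _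
      rw [this]; rfl
  have := enough_roots K _ hexp
  have : HasEnoughRootsOfUnity K (Monoid.exponent f.range) :=
    enough_roots K _ ((Monoid.exponent_submonoid_dvd f.range.toSubmonoid).trans hexp)
  rw [← CommGroup.card_monoidHom_of_hasEnoughRootsOfUnity f.range K]
  set Φ : (f.range →* Kˣ) → ((Fin n → Kˣ) →* Kˣ) := fun φ => φ.comp f.rangeRestrict with hΦ
  have hΦi : Function.Injective Φ := by
    intro a b hab
    exact (MonoidHom.cancel_right f.rangeRestrict_surjective).1 hab
  rw [← Nat.card_range_of_injective hΦi]
  change _ = Nat.card _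
  congr 2
  ext ψ
  constructor
  · rintro ⟨φ, rfl⟩
    obtain ⟨φ', rfl⟩ := MonoidHom.domRestrict_surjective
      (G := (Fin s → Kˣ) ⧸ diagSubgroup K s) K f.range φ
    obtain ⟨a, ha⟩ := char_eq_monChar K (φ'.comp (QuotientGroup.mk' (diagSubgroup K s)))
    refine ⟨a, ?_, ?_⟩
    · obtain ⟨g, hg⟩ := IsCyclic.exists_generator (α := Kˣ)
      have h1 := DFunLike.congr_fun ha (fun _ => g)
      have h2 : (QuotientGroup.mk' (diagSubgroup K s)) (fun _ => g) = 1 :=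
        (QuotientGroup.eq_one_iff _).2 ⟨g, rfl⟩
      rw [MonoidHom.comp_apply, h2, map_one] at h1
      simp only [monChar, MonoidHom.coe_mk, OneHom.coe_mk, Finset.prod_pow_eq_pow_sum] at h1
      have h3 := orderOf_dvd_of_pow_eq_one h1.symm
      rw [orderOf_eq_card_of_forall_mem_zpowers hg] at h3
      exact (ZMod.natCast_eq_zero_iff _ _).2 h3
    · unfold psi
      rw [← ha]
      rfl
  · rintro ⟨a, ha, rfl⟩
    have hk : diagSubgroup K s ≤ (monChar K a).ker := by
      rintro _ ⟨l, rfl⟩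
      rw [MonoidHom.mem_ker]
      simp only [monChar, MonoidHom.coe_mk, OneHom.coe_mk, Finset.prod_pow_eq_pow_sum]
      obtain ⟨c, hc⟩ := (ZMod.natCast_eq_zero_iff _ _).1 ha
      rw [hc, pow_mul, hpowN, one_pow]
    refine ⟨(QuotientGroup.lift _ (monChar K a) hk).comp f.range.subtype, ?_⟩
    ext x
    rfl

lemma psi_apply (K : Type) [Field K] {n s : ℕ} (U V : Fin s → Fin n)
    (e : Fin s → Sym2 (Fin n)) (heUV : ∀ j, e j = s(U j, V j)) (a : Fin s → ℕ) (x : Fin n → Kˣ) :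
    psi K e a x = ∏ v, x v ^ (∑ j, ((if U j = v then a j else 0) + (if V j = v then a j else 0))) := by
  simp only [psi, monChar, thetaHom, MonoidHom.comp_apply, MonoidHom.coe_mk, OneHom.coe_mk]
  simp_rw [← Finset.prod_pow_eq_pow_sum]
  rw [Finset.prod_comm]
  refine Finset.prod_congr rfl fun j _ => ?_
  rw [heUV]
  simp only [pow_add, Finset.prod_mul_distrib]
  simp [edgeProd, mul_pow, pow_ite, Finset.prod_ite_eq]

lemma psi_eq_iff (K : Type) [Field K] [Fintype K] {n s : ℕ} (U V : Fin s → Fin n)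
    (e : Fin s → Sym2 (Fin n)) (heUV : ∀ j, e j = s(U j, V j)) (a b : Fin s → ℕ) :
    psi K e a = psi K e b ↔ ∀ v, incOp U V (fun j => (a j : ZMod (Nat.card Kˣ))) v =
      incOp U V (fun j => (b j : ZMod (Nat.card Kˣ))) v := by
  classical
  have hcast : ∀ (a : Fin s → ℕ) v, incOp U V (fun j => (a j : ZMod (Nat.card Kˣ))) v =
      ((∑ j, ((if U j = v then a j else 0) + (if V j = v then a j else 0)) : ℕ) :
        ZMod (Nat.card Kˣ)) := by
    intro a v
    unfold incOp
    push_cast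
    rfl
  obtain ⟨g, hg⟩ := IsCyclic.exists_generator (α := Kˣ)
  have hord := orderOf_eq_card_of_forall_mem_zpowers hg
  constructor
  · intro h v
    rw [hcast, hcast, ZMod.natCast_eq_natCast_iff, ← hord, ← pow_eq_pow_iff_modEq]
    have h1 := DFunLike.congr_fun h (Pi.mulSingle v g)
    rw [psi_apply K U V e heUV, psi_apply K U V e heUV] at h1
    rw [Finset.prod_eq_single v, Finset.prod_eq_single v] at h1
    · simpa using h1
    all_goals simp +contextual [Pi.mulSingle_apply]
  · intro h
    apply MonoidHom.ext
    intro x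
    rw [psi_apply K U V e heUV, psi_apply K U V e heUV]
    refine Finset.prod_congr rfl fun v _ => ?_
    have h1 := h v
    rw [hcast, hcast, ZMod.natCast_eq_natCast_iff] at h1
    rw [pow_eq_pow_iff_modEq]
    exact h1.of_dvd (orderOf_dvd_natCard _)


theorem regularity_formula_disjoint_cycles
    (q n s m : ℕ) (hq : 2 < q) (hs : 2 ≤ s) (K : Type) [Field K] [Fintype K]
    (hcard : Fintype.card K = q)
    (e : Fin s → Sym2 (Fin n)) (he : Function.Injective e)
    (hnd : ∀ i, ¬ (e i).IsDiag)
    (hiso : ∀ v : Fin n, ∃ i, v ∈ e i)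
    (G : SimpleGraph (Fin n)) (hG : G = SimpleGraph.fromEdgeSet (Set.range e))
    (hconn : G.Connected) (hbip : G.Colorable 2)
    (E : Fin m → Finset (Fin s)) (kk : Fin m → ℕ)
    -- each `H_i` is a cycle subgraph of `G`, with edge set `{e j : j ∈ E i}`
    (hcyc : ∀ i : Fin m, ∃ (v : Fin n) (w : G.Walk v v), w.IsCycle ∧
      {x : Sym2 (Fin n) | x ∈ w.edges} = e '' ↑(E i))
    -- `H_i` has length `2 k_i`
    (hlen : ∀ i : Fin m, (E i).card = 2 * kk i)
    -- the vertex sets of the `H_i` are pairwise disjoint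
    (hdisj : ∀ i₁ i₂ : Fin m, i₁ ≠ i₂ → ∀ v : Fin n,
      (∃ j ∈ E i₁, v ∈ e j) → ¬ (∃ j ∈ E i₂, v ∈ e j))
    -- every cycle of `G` coincides with one of `H_1,…,H_m`
    (hall : ∀ (v : Fin n) (w : G.Walk v v), w.IsCycle →
      ∃ i : Fin m, {x : Sym2 (Fin n) | x ∈ w.edges} = e '' ↑(E i)) :
    (∀ d : ℕ, (q - 2) * (s - (∑ i, kk i) - 1) ≤ d →
        hilbertFn K (graphXstar K e) d = XCard K (graphXstar K e)) ∧
    hilbertFn K (graphXstar K e) ((q - 2) * (s - (∑ i, kk i) - 1) - 1) <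
      XCard K (graphXstar K e) := by
  classical
  have hNpos : 0 < Nat.card Kˣ := Nat.card_pos
  have hNq : Nat.card Kˣ = q - 1 := by
    rw [Nat.card_eq_fintype_card, Fintype.card_units, hcard]
  have hNZ : NeZero (Nat.card Kˣ) := ⟨hNpos.ne'⟩
  obtain ⟨col⟩ := hbip
  have hadj : ∀ u w, G.Adj u w → s(u, w) ∈ Set.range e := by
    intro u w h
    rw [hG, SimpleGraph.fromEdgeSet_adj] at h
    exact h.1
  have hchoose : ∀ j, ∃ u w, e j = s(u, w) ∧ G.Adj u w ∧ col u = 0 ∧ col w = 1 := by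
    intro j
    induction hj : e j with
    | _ a b =>
      have hab : G.Adj a b := by
        rw [hG, SimpleGraph.fromEdgeSet_adj]
        refine ⟨⟨j, hj⟩, ?_⟩
        have := hnd j
        rw [hj] at this
        simpa using this
      have hc := col.valid hab
      have h1 : col a = 0 ∨ col a = 1 := by omega
      rcases h1 with h1 | h1
      · exact ⟨a, b, rfl, hab, h1, by omega⟩
      · exact ⟨b, a, Sym2.eq_swap, hab.symm, by omega, h1⟩
  choose U V heUV hUVadj hcU hcV using hchoose
  set N := Nat.card Kˣ with hN
  set ε : Fin n → ZMod N := fun v => if col v = 0 then 1 else -1 with hε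
  have hεU : ∀ j, ε (U j) = 1 := fun j => by simp [hε, hcU]
  have hεV : ∀ j, ε (V j) = -1 := fun j => by simp [hε, hcV]
  have hε1 : ∀ v, ε v = 1 ∨ ε v = -1 := by
    intro v; by_cases h : col v = 0 <;> simp [hε, h]
  have hεadj : ∀ u w, G.Adj u w → ε w = - ε u := by
    intro u w h
    have hc := col.valid h
    by_cases h1 : col u = 0
    · have h2 : col w ≠ 0 := fun h => hc (h1.trans h.symm)
      simp [hε, h1, h2]
    · have h2 : col w = 0 := by omega
      simp [hε, h1, h2]
  have hmemE : ∀ i v (w : G.Walk v v), {x : Sym2 (Fin n) | x ∈ w.edges} = e '' ↑(E i) →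
      ∀ j, e j ∈ w.edges ↔ j ∈ E i := by
    intro i v w h j
    have : e j ∈ {x : Sym2 (Fin n) | x ∈ w.edges} ↔ e j ∈ e '' (E i : Set (Fin s)) := by rw [h]
    rw [he.mem_set_image] at this
    exact this
  have hUmem : ∀ j, U j ∈ e j := fun j => by rw [heUV]; simp
  have hEdis : ∀ i₁ i₂, i₁ ≠ i₂ → Disjoint (E i₁) (E i₂) := by
    intro i₁ i₂ h
    rw [Finset.disjoint_left]
    intro j h1 h2
    exact hdisj i₁ i₂ h (U j) ⟨j, h1, hUmem j⟩ ⟨j, h2, hUmem j⟩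
  choose cv cw hcw hcE using hcyc
  have hcard2 : (Finset.univ.biUnion E).card = 2 * ∑ i, kk i := by
    rw [Finset.card_biUnion fun i _ j _ hij => hEdis i j hij, Finset.mul_sum]
    exact Finset.sum_congr rfl fun i _ => hlen i
  have hle : 2 * ∑ i, kk i ≤ s := by
    rw [← hcard2]; simpa using Finset.card_le_univ (Finset.univ.biUnion E)
  -- upper bound
  have hupper := upper_rep N U V E kk hlen hEdis (fun i => walkVec e ε (cw i))
    (fun i j hj => walkVec_mem e ε hε1 G (cw i) (hcw i).edges_nodup j
      ((hmemE i _ _ (hcE i) j).2 hj))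
    (fun i j hj => walkVec_not_mem e ε G (cw i) j
      (fun h => hj ((hmemE i _ _ (hcE i) j).1 h)))
    (fun i v => by rw [walkVec_incOp U V e he heUV ε G hadj hεadj, sub_self])
  -- lower bound
  obtain ⟨b, hbsum, hbmin⟩ := lower_rep (k := ∑ i, kk i) N U V (Finset.univ.biUnion E) hcard2
    (fun i j h => by have h1 := hcU i; rw [h, hcV] at h1; exact absurd h1 (by decide))
    (fun κ hκ j hj => by
      refine bridge_ker U V e he heUV ε hεU hεV G hUVadj κ hκ j ?_
      rw [SimpleGraph.isBridge_iff_forall_cycle_notMem (by rw [heUV]; exact hUVadj j)]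
      intro u p hp hmem
      obtain ⟨i, hi⟩ := hall u p hp
      exact hj (Finset.mem_biUnion.2 ⟨i, Finset.mem_univ _, (hmemE i _ _ hi j).1 hmem⟩))
    (fun j hj => by
      obtain ⟨i, -, hji⟩ := Finset.mem_biUnion.1 hj
      have hmem := (hmemE i _ _ (hcE i) j).2 hji
      have hsup : U j ∈ (cw i).support := by
        rw [heUV] at hmem
        exact (cw i).fst_mem_support_of_mem_edges hmem
      rw [← (hcw i).ncard_neighborSet_toSubgraph_eq_two hsup, ← Set.ncard_coe_finset]
      refine Set.ncard_congr (fun a _ => V a) ?_ ?_ ?_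
      · intro a ha
        simp only [Finset.coe_filter, Finset.mem_biUnion, Finset.mem_univ, true_and,
          Set.mem_ofPred_eq] at ha
        obtain ⟨⟨i', hi'⟩, hU⟩ := ha
        have hii : i' = i := by
          by_contra hne
          exact hdisj i' i hne (U j) ⟨a, hi', hU ▸ hUmem a⟩ ⟨j, hji, hUmem j⟩
        subst hii
        rw [SimpleGraph.Subgraph.mem_neighborSet, SimpleGraph.Walk.adj_toSubgraph_iff_mem_edges,
          ← hU, ← heUV]
        exact (hmemE _ _ _ (hcE _) a).2 hi'
      · intro a a' ha ha' hV
        simp only [Finset.coe_filter, Set.mem_ofPred_eq] at ha ha'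
        apply he
        rw [heUV, heUV, ha.2, ha'.2, hV]
      · intro v hv
        rw [SimpleGraph.Subgraph.mem_neighborSet,
          SimpleGraph.Walk.adj_toSubgraph_iff_mem_edges] at hv
        have h1 : s(U j, v) ∈ e '' (E i : Set (Fin s)) := by rw [← hcE i]; exact hv
        obtain ⟨a, ha, hav⟩ := h1
        rw [heUV, Sym2.eq_iff] at hav
        have hav' : U a = U j ∧ V a = v := by
          rcases hav with h | h
          · exact h
          · have h1 := hcV a
            rw [h.2, hcU] at h1; exact absurd h1 (by decide)
        refine ⟨a, ?_, hav'.2⟩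
        simp only [Finset.coe_filter, Finset.mem_biUnion, Finset.mem_univ, true_and,
          Set.mem_ofPred_eq]
        exact ⟨⟨i, ha⟩, hav'.1⟩)
  have hpsi := psi_eq_iff K U V e heUV
  -- degrees are determined modulo `N`
  have hdeg : ∀ a a' : Fin s → ZMod N, (∀ v, incOp U V a v = incOp U V a' v) →
      ∑ j, a j = ∑ j, a' j := by
    intro a a' h
    have h1 : ∀ a : Fin s → ZMod N, ∑ v, (if col v = 0 then 1 else 0) * incOp U V a v =
        ∑ j, a j := by
      intro a
      rw [sum_incOp]
      refine Finset.sum_congr rfl fun j _ => ?_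
      simp [hcU, hcV]
    rw [← h1 a, ← h1 a']
    simp_rw [h]
  have hfinite : Finite ((Fin n → Kˣ) →* Kˣ) := DFunLike.finite _
  have hsub : ∀ d : ℕ, psi K e '' {a : Fin s → ℕ | ∑ j, a j = d} ⊆
      psi K e '' {a : Fin s → ℕ | ((∑ j, a j : ℕ) : ZMod N) = d} := by
    rintro d _ ⟨a, ha, rfl⟩
    refine ⟨a, ?_, rfl⟩
    rw [Set.mem_ofPred_eq] at ha ⊢
    rw [ha]
  set M := s - ∑ i, kk i with hM
  have hM2 : 2 ≤ M := by
    rcases Nat.eq_zero_or_pos m with h0 | h0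
    · subst h0
      simp [hM]; exact hs
    · have h3 := (hcw ⟨0, h0⟩).three_le_length
      have h4 : (E ⟨0, h0⟩).card = (cw ⟨0, h0⟩).length := by
        rw [← SimpleGraph.Walk.length_edges, ← List.toFinset_card_of_nodup (hcw ⟨0, h0⟩).edges_nodup,
          ← Finset.card_image_of_injective _ he]
        congr 1
        ext x
        have : x ∈ {x : Sym2 (Fin n) | x ∈ (cw ⟨0, h0⟩).edges} ↔ x ∈ e '' (E ⟨0, h0⟩ : Set (Fin s)) := by
          rw [hcE]
        rw [List.mem_toFinset, Finset.mem_image]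
        exact this.symm
      have h5 := hlen ⟨0, h0⟩
      have h6 : kk ⟨0, h0⟩ ≤ ∑ i, kk i :=
        Finset.single_le_sum (f := kk) (fun _ _ => Nat.zero_le _) (Finset.mem_univ _)
      omega
  have hell : (q - 2) * (M - 1) + (q - 2) = (N - 1) * M := by
    have : N - 1 = q - 2 := by omega
    rw [this]
    obtain ⟨M', hM'⟩ : ∃ M', M = M' + 1 := ⟨M - 1, by omega⟩
    rw [hM']; simp; ring
  have hellpos : 1 ≤ (q - 2) * (M - 1) := Nat.mul_pos (by omega) (by omega)
  set ℓ := (q - 2) * (M - 1) with hℓ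
  constructor
  · intro d hd
    rw [hilbert_eq, XCard_eq K (by omega) e d]
    congr 1
    refine (hsub d).antisymm ?_
    rintro _ ⟨a, ha, rfl⟩
    obtain ⟨c, hc, hcle⟩ := hupper (fun j => (a j : ZMod N))
    have hsum : ((∑ j, (c j).val : ℕ) : ZMod N) = d := by
      rw [Set.mem_ofPred_eq] at ha
      rw [← ha]
      push_cast
      simp only [ZMod.natCast_val, ZMod.cast_id', id]
      exact hdeg _ _ hc
    rw [ZMod.natCast_eq_natCast_iff] at hsum
    have hle' : ∑ j, (c j).val ≤ d := by
      by_contra hlt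
      push Not at hlt
      have h1 := (Nat.modEq_iff_dvd' hlt.le).1 hsum.symm
      have h2 := Nat.le_of_dvd (by omega) h1
      omega
    obtain ⟨r, hr⟩ := (Nat.modEq_iff_dvd' hle').1 hsum
    set j0 : Fin s := ⟨0, by omega⟩
    refine ⟨fun j => (c j).val + (if j = j0 then N * r else 0), ?_, ?_⟩
    · rw [Set.mem_ofPred_eq, Finset.sum_add_distrib]
      simp
      omega
    · rw [hpsi]
      intro v
      rw [← hc]
      congr 1
      funext j
      by_cases h : j = j0 <;> simp [h]
  · rw [hilbert_eq, XCard_eq K (by omega) e (ℓ - 1)]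
    refine Set.ncard_lt_ncard ⟨hsub _, fun h => ?_⟩ (Set.toFinite _)
    obtain ⟨a, ha, hab⟩ := h ⟨b, by
      rw [Set.mem_ofPred_eq, hbsum, ← hell]
      have : ℓ + (q - 2) = (ℓ - 1) + N := by omega
      rw [this]; simp, rfl⟩
    have h1 := hbmin a ((hpsi a b).1 hab)
    rw [Set.mem_ofPred_eq] at ha
    omega
end
end
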